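/- arXiv:2005.11745 — 5 statements merged into one kernel-verified Lean document; each statement's English description precedes it below -/
import Mathlib

section
/- Let ρ > 1/2 and let μ ∈ ℂ with Re μ < 1 + 1/ρ. Let δ_ρ be a real number satisfying π/(2ρ) < δ_ρ ≤ π/ρ if ρ > 1, and π/(2ρ) < δ_ρ < π if 1/2 < ρ ≤ 1. Let z = R·exp(iθ) with R > 0 and π/(2ρ) − δ_ρ + π < θ < −π/(2ρ) + δ_ρ + π. Then E_{ρ,μ}(z) = ∫_{0}^{∞} K_{ρ,μ}(r, δ_ρ, z) dr, where K_{ρ,μ}(r, φ, z) is the symmetric kernel. -/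
open scoped Real
open MeasureTheory intervalIntegral

/-- The two-parameter Mittag-Leffler function
`E_{ρ,μ}(z) = ∑_{k=0}^∞ z^k / Γ(μ + k/ρ)`. -/
noncomputable def ML (ρ : ℝ) (μ z : ℂ) : ℂ :=
  ∑' k : ℕ, z ^ k * (Complex.Gamma (μ + (k : ℂ) / (ρ : ℂ)))⁻¹

/-- `φ_{ρ,μ}(ζ,z) = (ρ/(2πi)) exp((ζz)^ρ) (ζz)^{ρ(1-μ)}` at `ζ = r e^{iφ}`,
on the branch fixed by `arg z = θ`, `z = R e^{iθ}`. -/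
noncomputable def phiFun (ρ : ℝ) (μ : ℂ) (R θ r φ : ℝ) : ℂ :=
  ((ρ : ℂ) / (2 * (π : ℂ) * Complex.I)) *
    Complex.exp (Complex.exp ((ρ : ℂ) * ((Real.log (R * r) : ℂ) + Complex.I * ((θ + φ : ℝ) : ℂ)))) *
    Complex.exp ((ρ : ℂ) * (1 - μ) * ((Real.log (R * r) : ℂ) + Complex.I * ((θ + φ : ℝ) : ℂ)))

/-- The (complex-valued) phase function `η(r,φ)`. -/
noncomputable def etaF (ρ : ℝ) (μ : ℂ) (R θ r φ : ℝ) : ℂ :=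
  Complex.exp ((ρ : ℂ) * ((Real.log (R * r) : ℂ) + Complex.I * ((θ - π : ℝ) : ℂ))) *
      Complex.sin ((ρ : ℂ) * (φ : ℂ)) +
    (ρ : ℂ) * (1 - μ) * (φ : ℂ)

/-- The function `A_{ρ,μ}(r,ω₁,ω₂,z)`. -/
noncomputable def AF (ρ : ℝ) (μ : ℂ) (R θ r ω₁ ω₂ : ℝ) : ℂ :=
  Complex.exp (Complex.exp ((ρ : ℂ) * ((Real.log (R * r) : ℂ) + Complex.I * ((θ - π : ℝ) : ℂ))) *
      Complex.cos ((ρ : ℂ) * (ω₁ : ℂ))) *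
    ((r ^ 2 + 2 * r * Real.cos ω₂ + 1 : ℝ) : ℂ) *
    Complex.exp (Complex.I * etaF ρ μ R θ r ω₁) *
    ((r : ℂ) + Complex.exp (Complex.I * (ω₁ : ℂ)))

/-- The kernel `K_{ρ,μ}(r,φ₁,φ₂,z)`. -/
noncomputable def KF (ρ : ℝ) (μ : ℂ) (R θ r φ₁ φ₂ : ℝ) : ℂ :=
  ((ρ : ℂ) / (2 * (π : ℂ) * Complex.I)) *
    Complex.exp ((ρ : ℂ) * (1 - μ) * ((Real.log (R * r) : ℂ) + Complex.I * (θ : ℂ))) *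
    Complex.exp (-(Complex.I * (ρ : ℂ) * (π : ℂ) * (1 - μ))) *
    (AF ρ μ R θ r φ₂ φ₁ - AF ρ μ R θ r φ₁ φ₂) /
    (((r ^ 2 + 2 * r * Real.cos φ₁ + 1 : ℝ) : ℂ) * ((r ^ 2 + 2 * r * Real.cos φ₂ + 1 : ℝ) : ℂ))

/-- The (complex-valued) phase function `χ(r,φ)`. -/
noncomputable def chiF (ρ : ℝ) (μ : ℂ) (R θ r φ : ℝ) : ℂ :=
  Complex.exp ((ρ : ℂ) * ((Real.log (R * r) : ℂ) + Complex.I * (θ : ℂ))) *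
      Complex.sin ((ρ : ℂ) * (φ : ℂ)) +
    (ρ : ℂ) * (1 - μ) * (φ : ℂ)

/-- The kernel `P_{ρ,μ}(r,φ,z)`. -/
noncomputable def PF (ρ : ℝ) (μ : ℂ) (R θ r φ : ℝ) : ℂ :=
  ((ρ : ℂ) / (2 * (π : ℂ))) *
    Complex.exp (Complex.exp ((ρ : ℂ) * ((Real.log (R * r) : ℂ) + Complex.I * (θ : ℂ))) *
      Complex.cos ((ρ : ℂ) * (φ : ℂ))) *
    Complex.exp ((ρ : ℂ) * (1 - μ) * ((Real.log (R * r) : ℂ) + Complex.I * (θ : ℂ))) *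
    Complex.exp (Complex.I * chiF ρ μ R θ r φ) *
    ((r : ℂ) * ((r : ℂ) - Complex.exp (Complex.I * (φ : ℂ)))) /
    ((r ^ 2 - 2 * r * Real.cos φ + 1 : ℝ) : ℂ)

/-- The symmetric kernel `K_{ρ,μ}(r,φ,z)` (case `δ₁ρ = δ₂ρ`). -/
noncomputable def KsymF (ρ : ℝ) (μ : ℂ) (R θ r φ : ℝ) : ℂ :=
  ((ρ : ℂ) / (π : ℂ)) *
    Complex.exp ((ρ : ℂ) * (1 - μ) * ((Real.log (R * r) : ℂ) + Complex.I * ((θ - π : ℝ) : ℂ))) *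
    Complex.exp (Complex.exp ((ρ : ℂ) * ((Real.log (R * r) : ℂ) + Complex.I * ((θ - π : ℝ) : ℂ))) *
      Complex.cos ((ρ : ℂ) * (φ : ℂ))) *
    ((r : ℂ) * Complex.sin (etaF ρ μ R θ r φ) + Complex.sin (etaF ρ μ R θ r φ + (φ : ℂ))) /
    ((r ^ 2 + 2 * r * Real.cos φ + 1 : ℝ) : ℂ)

/-- The kernel `K_{ρ,μ}(r,z)` (case `δρ = π/ρ`). -/
noncomputable def KpiF (ρ : ℝ) (μ : ℂ) (R θ r : ℝ) : ℂ :=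
  ((ρ : ℂ) / (π : ℂ)) *
    Complex.exp ((ρ : ℂ) * (1 - μ) * ((Real.log (R * r) : ℂ) + Complex.I * ((θ - π : ℝ) : ℂ))) *
    Complex.exp (-Complex.exp ((ρ : ℂ) * ((Real.log (R * r) : ℂ) + Complex.I * ((θ - π : ℝ) : ℂ)))) *
    ((r : ℂ) * Complex.sin ((π : ℂ) * (1 - μ)) +
      Complex.sin ((π : ℂ) * (1 - μ) + (π : ℂ) / (ρ : ℂ))) /
    ((r ^ 2 + 2 * r * Real.cos (π / ρ) + 1 : ℝ) : ℂ)

/-- The kernel `K′_{ρ,μ}(r,φ,z)`. -/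
noncomputable def KpF (ρ : ℝ) (μ : ℂ) (R θ r φ : ℝ) : ℂ :=
  ((ρ : ℂ) / (2 * (π : ℂ) * Complex.I)) *
    Complex.exp (Complex.exp ((ρ : ℂ) * ((Real.log (R * r) : ℂ) + Complex.I * ((θ - π : ℝ) : ℂ))) *
      Complex.cos ((ρ : ℂ) * (φ : ℂ))) *
    Complex.exp ((ρ : ℂ) * (1 - μ) * ((Real.log (R * r) : ℂ) + Complex.I * (θ : ℂ))) *
    Complex.exp (Complex.I * (etaF ρ μ R θ r φ - (π : ℂ) * (ρ : ℂ) * (1 - μ))) *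
    ((r : ℂ) + Complex.exp (Complex.I * (φ : ℂ))) /
    ((r ^ 2 + 2 * r * Real.cos φ + 1 : ℝ) : ℂ)

/-- `r(τ,ψ) = √(τ² + 2τ cos ψ + 1)`. -/
noncomputable def rP (τ ψ : ℝ) : ℝ := Real.sqrt (τ ^ 2 + 2 * τ * Real.cos ψ + 1)

/-- `φ(τ,ψ,k) = arctan(τ sin ψ / (τ cos ψ + 1)) + kπ`. -/
noncomputable def phiP (τ ψ : ℝ) (k : ℤ) : ℝ :=
  Real.arctan (τ * Real.sin ψ / (τ * Real.cos ψ + 1)) + k * π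

/-- The (complex-valued) phase `χ′(τ,ψ,k,z)`. -/
noncomputable def chiP (ρ : ℝ) (μ : ℂ) (R θ τ ψ : ℝ) (k : ℤ) : ℂ :=
  Complex.exp ((ρ : ℂ) * ((Real.log (R * rP τ ψ) : ℂ) + Complex.I * (θ : ℂ))) *
      Complex.sin ((ρ : ℂ) * (phiP τ ψ k : ℂ)) +
    (ρ : ℂ) * (1 - μ) * (phiP τ ψ k : ℂ)

/-- The kernel `P′_{ρ,μ}(τ,ψ,k,z)`. -/
noncomputable def PpF (ρ : ℝ) (μ : ℂ) (R θ τ ψ : ℝ) (k : ℤ) : ℂ :=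
  ((ρ * τ : ℝ) : ℂ) / (2 * (π : ℂ)) *
    Complex.exp (Complex.exp ((ρ : ℂ) * ((Real.log (R * rP τ ψ) : ℂ) + Complex.I * (θ : ℂ))) *
      Complex.cos ((ρ : ℂ) * (phiP τ ψ k : ℂ))) *
    Complex.exp ((ρ : ℂ) * (1 - μ) * ((Real.log (R * rP τ ψ) : ℂ) + Complex.I * (θ : ℂ))) *
    Complex.exp (Complex.I * (chiP ρ μ R θ τ ψ k + (ψ : ℂ))) *
    ((rP τ ψ : ℂ) * Complex.exp (-(Complex.I * (phiP τ ψ k : ℂ))) - 1) /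
    ((rP τ ψ ^ 2 - 2 * rP τ ψ * Real.cos (phiP τ ψ k) + 1 : ℝ) : ℂ)

open Filter Topology Set

/-- The integrand `exp (e ^ v + (1 - s) v)` of Hankel's integral for `1 / Γ(s)`
in the logarithmic coordinate `v`. -/
noncomputable def hankelKernel (s v : ℂ) : ℂ :=
  Complex.exp (Complex.exp v + (1 - s) * v)

/-- The integral of `f` along the contour running from `∞ + b₁ i` to `c + b₁ i`,
then to `c + b₂ i`, then to `∞ + b₂ i`. -/
noncomputable def hankelContour (c b₁ b₂ : ℝ) (f : ℂ → ℂ) : ℂ :=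
  (∫ x : ℝ in Ioi c, f (x + b₂ * Complex.I)) - (∫ x : ℝ in Ioi c, f (x + b₁ * Complex.I)) +
    Complex.I * ∫ y : ℝ in b₁..b₂, f (c + y * Complex.I)

lemma differentiable_hankelKernel (s : ℂ) : Differentiable ℂ (hankelKernel s) := by
  unfold hankelKernel
  fun_prop

lemma continuous_hankelKernel_uncurry :
    Continuous fun p : ℂ × ℂ => hankelKernel p.1 p.2 := by
  unfold hankelKernel
  fun_prop

@[fun_prop]
lemma Continuous.hankelKernel {X : Type*} [TopologicalSpace X] {f g : X → ℂ}
    (hf : Continuous f) (hg : Continuous g) :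
    Continuous fun x => hankelKernel (f x) (g x) :=
  continuous_hankelKernel_uncurry.comp (hf.prodMk hg)

lemma norm_hankelKernel (s : ℂ) (x y : ℝ) :
    ‖hankelKernel s (x + y * Complex.I)‖ =
      Real.exp (Real.exp x * Real.cos y + ((1 - s.re) * x + s.im * y)) := by
  rw [hankelKernel, Complex.norm_exp]
  simp [Complex.exp_re]

lemma isBigO_exp_exp_mul_add_mul {k : ℝ} (hk : k < 0) (A : ℝ) :
    (fun x : ℝ => Real.exp (Real.exp x * k + A * x)) =O[atTop] fun x => Real.exp (-1 * x) := by
  refine Asymptotics.IsBigO.of_bound 1 ?_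
  filter_upwards [eventually_ge_atTop 0, eventually_ge_atTop (2 * (A + 1) / (-k))] with x h0 hx
  rw [Real.norm_of_nonneg (Real.exp_pos _).le, Real.norm_of_nonneg (Real.exp_pos _).le, one_mul,
    Real.exp_le_exp]
  have h1 := Real.quadratic_le_exp_of_nonneg h0
  rw [div_le_iff₀ (by linarith)] at hx
  nlinarith [mul_le_mul_of_nonneg_left hx h0]

lemma integrableOn_exp_exp_mul_add_mul {k : ℝ} (hk : k < 0) (A c : ℝ) :
    IntegrableOn (fun x : ℝ => Real.exp (Real.exp x * k + A * x)) (Ioi c) :=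
  integrable_of_isBigO_exp_neg one_pos (by fun_prop) (isBigO_exp_exp_mul_add_mul hk A)

lemma integrableOn_Ioi_hankelKernel (s : ℂ) {b : ℝ} (hb : Real.cos b < 0) (c : ℝ) :
    IntegrableOn (fun x : ℝ => hankelKernel s (x + b * Complex.I)) (Ioi c) := by
  refine ((integrableOn_exp_exp_mul_add_mul hb (1 - s.re) c).mul_const
    (Real.exp (s.im * b))).mono' (by fun_prop) (ae_of_all _ fun x => ?_)
  rw [norm_hankelKernel, ← Real.exp_add, add_assoc]

/-- On the half strip `x ≤ c`, the kernel decays exponentially to the left. -/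
lemma norm_hankelKernel_le (s : ℂ) {x y c C : ℝ} (hx : x ≤ c) (hy : |y| ≤ C) :
    ‖hankelKernel s (x + y * Complex.I)‖ ≤
      Real.exp ((1 - s.re) * x) * Real.exp (Real.exp c + |s.im| * C) := by
  rw [norm_hankelKernel, ← Real.exp_add, Real.exp_le_exp]
  have h1 : Real.exp x * Real.cos y ≤ Real.exp c :=
    (mul_le_of_le_one_right (Real.exp_pos x).le (Real.cos_le_one y)).trans (Real.exp_le_exp.2 hx)
  have h2 : s.im * y ≤ |s.im| * C := by
    refine (le_abs_self _).trans ?_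
    rw [abs_mul]
    gcongr
  linarith

lemma integrableOn_Iic_hankelKernel {s : ℂ} (hs : s.re < 1) (b c : ℝ) :
    IntegrableOn (fun x : ℝ => hankelKernel s (x + b * Complex.I)) (Iic c) := by
  refine ((integrableOn_exp_mul_Iic (sub_pos.2 hs) c).mul_const
    (Real.exp (Real.exp c + |s.im| * |b|))).mono' (by fun_prop) ?_
  filter_upwards [ae_restrict_mem measurableSet_Iic] with x hx
  exact norm_hankelKernel_le s hx le_rfl

lemma integrable_hankelKernel {s : ℂ} (hs : s.re < 1) {b : ℝ} (hb : Real.cos b < 0) :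
    Integrable (fun x : ℝ => hankelKernel s (x + b * Complex.I)) := by
  rw [← integrableOn_univ, ← Iic_union_Ioi (a := 0)]
  exact (integrableOn_Iic_hankelKernel hs b 0).union (integrableOn_Ioi_hankelKernel s hb 0)

lemma cauchy_rectangle {f : ℂ → ℂ} {b₁ b₂ : ℝ}
    (hf : DifferentiableOn ℂ f {v | v.im ∈ uIcc b₁ b₂}) (p q : ℝ) :
    (∫ x : ℝ in p..q, f (x + b₂ * Complex.I)) - (∫ x : ℝ in p..q, f (x + b₁ * Complex.I)) =
      Complex.I * (∫ y : ℝ in b₁..b₂, f (q + y * Complex.I)) -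
      Complex.I * ∫ y : ℝ in b₁..b₂, f (p + y * Complex.I) := by
  have h := Complex.integral_boundary_rect_eq_zero_of_differentiableOn f
    (p + b₁ * Complex.I) (q + b₂ * Complex.I) (hf.mono fun v hv => by
      have h := (Complex.mem_reProdIm.1 hv).2
      simpa using h)
  simp only [Complex.add_re, Complex.ofReal_re, Complex.mul_re, Complex.I_re, mul_zero,
    Complex.ofReal_im, Complex.I_im, mul_one, sub_self, add_zero, Complex.add_im, Complex.mul_im,
    zero_add, smul_eq_mul] at h
  linear_combination -h

lemma abs_le_of_mem_uIcc {b₁ b₂ y : ℝ} (hy : y ∈ uIcc b₁ b₂) : |y| ≤ |b₁| + |b₂| := by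
  rw [abs_le]
  have := neg_abs_le b₁
  have := neg_abs_le b₂
  have := le_abs_self b₁
  have := le_abs_self b₂
  have := abs_nonneg b₁
  have := abs_nonneg b₂
  rcases mem_uIcc.1 hy with h | h <;> constructor <;> linarith

/-- A bounded multiple of the Hankel kernel, integrated over a vertical segment moving to the
left, tends to zero. -/
lemma tendsto_vertical_atBot {s : ℂ} (hs : s.re < 1) {b₁ b₂ M : ℝ} {B : ℂ → ℂ}
    (hM : ∀ v : ℂ, v.im ∈ uIcc b₁ b₂ → ‖B v‖ ≤ M) :
    Tendsto (fun p : ℝ => ∫ y : ℝ in b₁..b₂,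
      hankelKernel s (p + y * Complex.I) * B (p + y * Complex.I)) atBot (𝓝 0) := by
  set K := Real.exp (Real.exp 0 + |s.im| * (|b₁| + |b₂|))
  have hlim : Tendsto (fun p : ℝ => Real.exp ((1 - s.re) * p) * K * M * |b₂ - b₁|)
      atBot (𝓝 0) := by
    have h : Tendsto (fun p : ℝ => Real.exp ((1 - s.re) * p)) atBot (𝓝 0) :=
      Real.tendsto_exp_atBot.comp (tendsto_id.const_mul_atBot (sub_pos.2 hs))
    simpa using ((h.mul_const K).mul_const M).mul_const |b₂ - b₁|
  refine squeeze_zero_norm' ?_ hlim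
  filter_upwards [eventually_le_atBot 0] with p hp
  refine norm_integral_le_of_norm_le_const fun y hy => ?_
  have hy' := uIoc_subset_uIcc hy
  rw [norm_mul]
  exact mul_le_mul (norm_hankelKernel_le s hp (abs_le_of_mem_uIcc hy'))
    (hM _ (by simpa using hy')) (norm_nonneg _) (by positivity)

lemma tendsto_vertical_atTop (s : ℂ) {b₁ b₂ k : ℝ} (hk : k < 0)
    (hcos : ∀ y ∈ uIcc b₁ b₂, Real.cos y ≤ k) :
    Tendsto (fun p : ℝ => ∫ y : ℝ in b₁..b₂, hankelKernel s (p + y * Complex.I))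
      atTop (𝓝 0) := by
  set K := Real.exp (|s.im| * (|b₁| + |b₂|))
  have hlim : Tendsto (fun p : ℝ => Real.exp (Real.exp p * k + (1 - s.re) * p) * K * |b₂ - b₁|)
      atTop (𝓝 0) := by
    have h := (isBigO_exp_exp_mul_add_mul hk (1 - s.re)).trans_tendsto
      (Real.tendsto_exp_atBot.comp (tendsto_id.const_mul_atTop_of_neg (by norm_num)))
    simpa using (h.mul_const K).mul_const |b₂ - b₁|
  refine squeeze_zero_norm (fun p => ?_) hlim
  refine norm_integral_le_of_norm_le_const fun y hy => ?_
  have hy' := uIoc_subset_uIcc hy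
  rw [norm_hankelKernel, ← Real.exp_add, Real.exp_le_exp]
  have h1 : Real.exp p * Real.cos y ≤ Real.exp p * k :=
    mul_le_mul_of_nonneg_left (hcos y hy') (Real.exp_pos p).le
  have h2 : s.im * y ≤ |s.im| * (|b₁| + |b₂|) := by
    refine (le_abs_self _).trans ?_
    rw [abs_mul]
    gcongr
    exact abs_le_of_mem_uIcc hy'
  linarith

/-- The integral of the Hankel kernel over a horizontal line does not change when the line moves
inside a strip where `cos` is negative. -/
lemma integral_hankelKernel_line_eq {s : ℂ} (hs : s.re < 1) {b₁ b₂ k : ℝ} (hk : k < 0)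
    (hcos : ∀ y ∈ uIcc b₁ b₂, Real.cos y ≤ k) :
    ∫ x : ℝ, hankelKernel s (x + b₂ * Complex.I) =
      ∫ x : ℝ, hankelKernel s (x + b₁ * Complex.I) := by
  have hi (b : ℝ) (hb : b ∈ uIcc b₁ b₂) := intervalIntegral_tendsto_integral
    (integrable_hankelKernel hs ((hcos b hb).trans_lt hk))
    tendsto_neg_atTop_atBot tendsto_id
  have hl := (hi b₂ right_mem_uIcc).sub (hi b₁ left_mem_uIcc)
  have hr := ((tendsto_vertical_atTop s hk hcos).const_mul Complex.I).sub
    (((tendsto_vertical_atBot (B := fun _ => 1) (M := 1) (b₁ := b₁) (b₂ := b₂) hs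
      (by simp)).comp tendsto_neg_atTop_atBot).const_mul Complex.I)
  simp only [mul_one, mul_zero, sub_self] at hr
  rw [← sub_eq_zero]
  refine tendsto_nhds_unique (hl.congr fun p => ?_) hr
  exact cauchy_rectangle (differentiable_hankelKernel s).differentiableOn _ _

lemma integrable_hankelKernel_mul {s : ℂ} (hs : s.re < 1) {b₁ b₂ M b : ℝ} {B : ℂ → ℂ}
    (hB : DifferentiableOn ℂ B {v | v.im ∈ uIcc b₁ b₂})
    (hM : ∀ v : ℂ, v.im ∈ uIcc b₁ b₂ → ‖B v‖ ≤ M) (hb : b ∈ uIcc b₁ b₂)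
    (hcos : Real.cos b < 0) :
    Integrable fun x : ℝ => hankelKernel s (x + b * Complex.I) * B (x + b * Complex.I) := by
  refine (integrable_hankelKernel hs hcos).mul_bdd (c := M) ?_
    (ae_of_all _ fun x => hM _ (by simpa using hb))
  exact (hB.continuousOn.comp_continuous (by fun_prop)
    fun x => by simpa using hb).aestronglyMeasurable

/-- The Hankel contour collapses onto the two lines containing its rays. -/
lemma hankelContour_eq_integral_sub {s : ℂ} (hs : s.re < 1) {b₁ b₂ M : ℝ} {B : ℂ → ℂ}
    (hb₁ : Real.cos b₁ < 0) (hb₂ : Real.cos b₂ < 0)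
    (hB : DifferentiableOn ℂ B {v | v.im ∈ uIcc b₁ b₂})
    (hM : ∀ v : ℂ, v.im ∈ uIcc b₁ b₂ → ‖B v‖ ≤ M) (c : ℝ) :
    hankelContour c b₁ b₂ (fun v => hankelKernel s v * B v) =
      (∫ x : ℝ, hankelKernel s (x + b₂ * Complex.I) * B (x + b₂ * Complex.I)) -
        ∫ x : ℝ, hankelKernel s (x + b₁ * Complex.I) * B (x + b₁ * Complex.I) := by
  have h₁ := integrable_hankelKernel_mul hs hB hM left_mem_uIcc hb₁
  have h₂ := integrable_hankelKernel_mul hs hB hM right_mem_uIcc hb₂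
  have hl := (intervalIntegral_tendsto_integral_Iic c h₂.integrableOn tendsto_id).sub
    (intervalIntegral_tendsto_integral_Iic c h₁.integrableOn tendsto_id)
  have hr := ((tendsto_vertical_atBot hs hM).const_mul Complex.I).const_sub
    (Complex.I * ∫ y : ℝ in b₁..b₂,
      hankelKernel s (c + y * Complex.I) * B (c + y * Complex.I))
  have key := tendsto_nhds_unique (hl.congr fun p => cauchy_rectangle
    ((differentiable_hankelKernel s).differentiableOn.mul hB) p c) hr
  rw [hankelContour, ← integral_Iic_add_Ioi h₁.integrableOn (h₁.integrableOn (s := Ioi c)),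
    ← integral_Iic_add_Ioi h₂.integrableOn (h₂.integrableOn (s := Ioi c))]
  linear_combination -key

lemma integral_Ioi_eq_integral_exp_smul {E : Type*} [NormedAddCommGroup E] [NormedSpace ℝ E]
    {p : ℝ} (hp : 0 < p) (q : ℝ) (g : ℝ → E) :
    ∫ t in Ioi (0 : ℝ), g t = ∫ x : ℝ, (p * Real.exp (p * x + q)) • g (Real.exp (p * x + q)) := by
  have himg : (fun x : ℝ => Real.exp (p * x + q)) '' univ = Ioi 0 := by
    ext t
    simp only [image_univ, mem_range, mem_Ioi]
    refine ⟨fun ⟨x, hx⟩ => hx ▸ Real.exp_pos _, fun ht => ⟨(Real.log t - q) / p, ?_⟩⟩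
    rw [mul_div_cancel₀ _ hp.ne', sub_add_cancel, Real.exp_log ht]
  have hd (x : ℝ) : HasDerivAt (fun x : ℝ => Real.exp (p * x + q))
      (p * Real.exp (p * x + q)) x := by
    simpa [mul_comm] using (((hasDerivAt_id x).const_mul p).add_const q).exp
  rw [← himg, integral_image_eq_integral_abs_deriv_smul MeasurableSet.univ
    (fun x _ => (hd x).hasDerivWithinAt) (fun x _ y _ hxy => ?_) g]
  · simp only [Measure.restrict_univ, abs_of_pos (mul_pos hp (Real.exp_pos _))]
  · have := Real.exp_injective hxy
    simpa [hp.ne'] using this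

lemma integral_exp_neg_exp_add_mul {a : ℂ} (ha : 0 < a.re) :
    ∫ x : ℝ, Complex.exp (-Complex.exp x + a * x) = Complex.Gamma a := by
  rw [Complex.Gamma_eq_integral ha, Complex.GammaIntegral,
    integral_Ioi_eq_integral_exp_smul one_pos 0]
  congr 1 with x
  rw [Complex.real_smul, Complex.cpow_def_of_ne_zero (by simp)]
  simp only [one_mul, add_zero]
  rw [← Complex.ofReal_log (Real.exp_pos x).le, Real.log_exp]
  push_cast
  rw [← Complex.exp_add, ← Complex.exp_add]
  ring_nf

/-- The line integral of the Hankel kernel near the line `Im v = ε π`, with `ε = ± 1`. -/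
lemma integral_hankelKernel_line {s : ℂ} (hs : s.re < 1) {b ε : ℝ} (hε : ε = 1 ∨ ε = -1)
    (hb : |b - ε * π| < π / 2) :
    ∫ x : ℝ, hankelKernel s (x + b * Complex.I) =
      Complex.exp (ε * π * Complex.I * (1 - s)) * Complex.Gamma (1 - s) := by
  have hcos (y : ℝ) : Real.cos y = -Real.cos (y - ε * π) := by
    rcases hε with rfl | rfl
    · simp
    · simp [Real.cos_add]
  have hk : -Real.cos (b - ε * π) < 0 :=
    neg_lt_zero.2 (Real.cos_pos_of_mem_Ioo (abs_lt.1 hb))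
  rw [integral_hankelKernel_line_eq hs (b₁ := ε * π) hk,
    ← integral_exp_neg_exp_add_mul (by simpa using hs), ← MeasureTheory.integral_const_mul]
  · congr 1 with x
    rw [hankelKernel, ← Complex.exp_add, Complex.exp_add x]
    have he : Complex.exp ((ε * π : ℝ) * Complex.I) = -1 := by
      rcases hε with rfl | rfl
      · simp
      · simp [Complex.exp_neg]
    rw [he]
    push_cast
    ring_nf
  · intro y hy
    rw [hcos y, neg_le_neg_iff, ← Real.cos_abs (y - _), ← Real.cos_abs (b - _)]
    refine Real.cos_le_cos_of_nonneg_of_le_pi (abs_nonneg _) (by linarith [Real.pi_pos]) ?_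
    rcases mem_uIcc.1 hy with h | h
    · rw [abs_of_nonneg (by linarith), abs_of_nonneg (by linarith)]
      linarith
    · rw [abs_of_nonpos (by linarith), abs_of_nonpos (by linarith)]
      linarith

lemma inv_Gamma_eq_sin_mul {s : ℂ} (hs : s.re < 1) :
    (Complex.Gamma s)⁻¹ = Complex.sin (π * (1 - s)) * Complex.Gamma (1 - s) / π := by
  have hΓ : Complex.Gamma (1 - s) ≠ 0 := Complex.Gamma_ne_zero_of_re_pos (by simpa using hs)
  have h := Complex.Gamma_mul_Gamma_one_sub s
  rw [← eq_div_iff hΓ] at h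
  rw [h, mul_sub, mul_one, Complex.sin_pi_sub]
  simp only [inv_div, div_div_eq_mul_div]
  ring

lemma hankelContour_hankelKernel_of_re_lt_one {s : ℂ} (hs : s.re < 1) {b₁ b₂ : ℝ}
    (hb₁ : |b₁ + π| < π / 2) (hb₂ : |b₂ - π| < π / 2) (hcos₁ : Real.cos b₁ < 0)
    (hcos₂ : Real.cos b₂ < 0) (c : ℝ) :
    hankelContour c b₁ b₂ (hankelKernel s) = 2 * π * Complex.I * (Complex.Gamma s)⁻¹ := by
  have h := hankelContour_eq_integral_sub (B := fun _ => 1) (M := 1) hs hcos₁ hcos₂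
    (by fun_prop) (by simp) c
  simp only [mul_one] at h
  have hπ : (π : ℂ) ≠ 0 := by simp [Real.pi_ne_zero]
  rw [show hankelKernel s = fun v => hankelKernel s v from rfl, h,
    integral_hankelKernel_line hs (ε := 1) (Or.inl rfl) (by simpa using hb₂),
    integral_hankelKernel_line hs (ε := -1) (Or.inr rfl) (by simpa using hb₁),
    inv_Gamma_eq_sin_mul hs, Complex.sin]
  push_cast
  field_simp
  rw [Complex.I_sq]
  ring_nf

lemma tendsto_hankelKernel_atTop (s : ℂ) {b : ℝ} (hb : Real.cos b < 0) :
    Tendsto (fun x : ℝ => hankelKernel s (x + b * Complex.I)) atTop (𝓝 0) := by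
  have h := ((isBigO_exp_exp_mul_add_mul hb (1 - s.re)).trans_tendsto
    (Real.tendsto_exp_atBot.comp (tendsto_id.const_mul_atTop_of_neg
      (by norm_num)))).mul_const (Real.exp (s.im * b))
  rw [zero_mul] at h
  refine squeeze_zero_norm (fun x => ?_) h
  rw [norm_hankelKernel, ← Real.exp_add, add_assoc]

lemma hasDerivAt_hankelKernel_add_one (s v : ℂ) :
    HasDerivAt (hankelKernel (s + 1)) (hankelKernel s v - s * hankelKernel (s + 1) v) v := by
  have h := ((Complex.hasDerivAt_exp v).add ((hasDerivAt_id v).const_mul (1 - (s + 1)))).cexp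
  refine h.congr_deriv ?_
  have h2 : hankelKernel s v = Complex.exp (Complex.exp v + (1 - (s + 1)) * v) * Complex.exp v := by
    rw [hankelKernel, ← Complex.exp_add]
    ring_nf
  rw [h2, hankelKernel]
  simp only [Pi.add_apply, id]
  ring

lemma hankelContour_hankelKernel_recurrence (s : ℂ) {b₁ b₂ : ℝ}
    (hb₁ : Real.cos b₁ < 0) (hb₂ : Real.cos b₂ < 0) (c : ℝ) :
    hankelContour c b₁ b₂ (hankelKernel s) =
      s * hankelContour c b₁ b₂ (hankelKernel (s + 1)) := by
  have hray (b : ℝ) (hb : Real.cos b < 0) :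
      (∫ x : ℝ in Ioi c, hankelKernel s (x + b * Complex.I)) -
        s * ∫ x : ℝ in Ioi c, hankelKernel (s + 1) (x + b * Complex.I) =
      0 - hankelKernel (s + 1) (c + b * Complex.I) := by
    have hi := integrableOn_Ioi_hankelKernel s hb c
    have hi' := (integrableOn_Ioi_hankelKernel (s + 1) hb c).const_mul s
    rw [← MeasureTheory.integral_const_mul, ← MeasureTheory.integral_sub hi hi']
    refine integral_Ioi_of_hasDerivAt_of_tendsto'
      (f := fun x : ℝ => hankelKernel (s + 1) (x + b * Complex.I)) (fun x _ => ?_)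
      (hi.sub hi') (tendsto_hankelKernel_atTop _ hb)
    have h := (hasDerivAt_hankelKernel_add_one s (x + b * Complex.I)).comp_add_const
      (x : ℂ) (b * Complex.I)
    exact h.comp_ofReal
  have hseg : Complex.I * (∫ y : ℝ in b₁..b₂, hankelKernel s (c + y * Complex.I)) -
      s * (Complex.I * ∫ y : ℝ in b₁..b₂, hankelKernel (s + 1) (c + y * Complex.I)) =
      hankelKernel (s + 1) (c + b₂ * Complex.I) - hankelKernel (s + 1) (c + b₁ * Complex.I) := by
    rw [mul_left_comm s, ← mul_sub, ← intervalIntegral.integral_const_mul,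
      ← intervalIntegral.integral_sub (Continuous.intervalIntegrable (by fun_prop) _ _)
        (Continuous.intervalIntegrable (by fun_prop) _ _),
      ← intervalIntegral.integral_const_mul]
    refine integral_eq_sub_of_hasDerivAt
      (f := fun y : ℝ => hankelKernel (s + 1) (c + y * Complex.I)) (fun y _ => ?_)
      (Continuous.intervalIntegrable (by fun_prop) _ _)
    have h := (hasDerivAt_hankelKernel_add_one s (c + y * Complex.I)).comp (y : ℂ)
      (((hasDerivAt_id (y : ℂ)).mul_const Complex.I).const_add (c : ℂ))
    refine h.comp_ofReal.congr_deriv ?_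
    ring
  unfold hankelContour
  linear_combination hray b₂ hb₂ - hray b₁ hb₁ + hseg

lemma continuous_integral_Ioi_hankelKernel {b : ℝ} (hb : Real.cos b < 0) (c : ℝ) :
    Continuous fun s : ℂ => ∫ x : ℝ in Ioi c, hankelKernel s (x + b * Complex.I) := by
  rw [continuous_iff_continuousAt]
  intro s₀
  refine continuousAt_of_dominated (bound := fun x : ℝ =>
    (Real.exp (Real.exp x * Real.cos b + (1 - s₀.re + 1) * x) +
      Real.exp (Real.exp x * Real.cos b + (1 - s₀.re - 1) * x)) *
      Real.exp ((|s₀.im| + 1) * |b|))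
    (Eventually.of_forall fun s => by fun_prop) ?_
    (((integrableOn_exp_exp_mul_add_mul hb _ c).add
      (integrableOn_exp_exp_mul_add_mul hb _ c)).mul_const _)
    (ae_of_all _ fun x => by fun_prop)
  filter_upwards [Metric.ball_mem_nhds s₀ one_pos] with s hs
  refine ae_of_all _ fun x => ?_
  rw [mem_ball_iff_norm] at hs
  have hre := abs_le.1 ((Complex.abs_re_le_norm (s - s₀)).trans hs.le)
  have him := (Complex.abs_im_le_norm (s - s₀)).trans hs.le
  rw [Complex.sub_re] at hre
  rw [Complex.sub_im] at him
  rw [norm_hankelKernel, ← add_assoc, Real.exp_add]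
  have h2 : s.im * b ≤ (|s₀.im| + 1) * |b| := by
    refine (le_abs_self _).trans ?_
    rw [abs_mul]
    gcongr
    linarith [abs_sub_abs_le_abs_sub s.im s₀.im]
  refine mul_le_mul ?_ (Real.exp_le_exp.2 h2) (Real.exp_pos _).le (by positivity)
  rcases le_total 0 x with hx | hx
  · refine le_add_of_le_of_nonneg (Real.exp_le_exp.2 ?_) (Real.exp_pos _).le
    nlinarith
  · refine le_add_of_nonneg_of_le (Real.exp_pos _).le (Real.exp_le_exp.2 ?_)
    nlinarith

lemma continuous_hankelContour_hankelKernel {b₁ b₂ : ℝ}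
    (hb₁ : Real.cos b₁ < 0) (hb₂ : Real.cos b₂ < 0) (c : ℝ) :
    Continuous fun s : ℂ => hankelContour c b₁ b₂ (hankelKernel s) := by
  unfold hankelContour
  exact ((continuous_integral_Ioi_hankelKernel hb₂ c).sub
    (continuous_integral_Ioi_hankelKernel hb₁ c)).add
    (continuous_const.mul (continuous_parametric_intervalIntegral_of_continuous' (by fun_prop) _ _))

/-- **Hankel's formula** for the reciprocal of the Gamma function. -/
theorem hankelContour_hankelKernel (s : ℂ) {b₁ b₂ : ℝ}
    (hb₁ : |b₁ + π| < π / 2) (hb₂ : |b₂ - π| < π / 2) (hcos₁ : Real.cos b₁ < 0)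
    (hcos₂ : Real.cos b₂ < 0) (c : ℝ) :
    hankelContour c b₁ b₂ (hankelKernel s) = 2 * π * Complex.I * (Complex.Gamma s)⁻¹ := by
  obtain ⟨n, hn⟩ := exists_nat_gt (s.re - 1)
  induction n generalizing s with
  | zero =>
    exact hankelContour_hankelKernel_of_re_lt_one (by simpa using hn) hb₁ hb₂ hcos₁ hcos₂ c
  | succ n ih =>
    have hne (t : ℂ) (ht : t ≠ 1) (htn : t.re - 1 < (n + 1 : ℕ)) :
        hankelContour c b₁ b₂ (hankelKernel t) = 2 * π * Complex.I * (Complex.Gamma t)⁻¹ := by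
      have h := hankelContour_hankelKernel_recurrence (t - 1) hcos₁ hcos₂ c
      rw [ih (t - 1) (by push_cast at htn; simp; linarith),
        Complex.one_div_Gamma_eq_self_mul_one_div_Gamma_add_one, sub_add_cancel] at h
      refine mul_left_cancel₀ (sub_ne_zero.2 ht) ?_
      linear_combination -h
    by_cases hs : s = 1
    · subst hs
      refine tendsto_nhds_unique (f := fun t => hankelContour c b₁ b₂ (hankelKernel t))
        (l := 𝓝[≠] 1)
        ((continuous_hankelContour_hankelKernel hcos₁ hcos₂ c).continuousAt.mono_left
          nhdsWithin_le_nhds) ?_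
      have hΓ := (continuous_const.mul Complex.differentiable_one_div_Gamma.continuous :
        Continuous fun t => 2 * π * Complex.I * (Complex.Gamma t)⁻¹)
      refine (hΓ.continuousAt.mono_left nhdsWithin_le_nhds).congr' ?_
      have hopen : IsOpen {t : ℂ | t.re - 1 < (n + 1 : ℕ)} :=
        isOpen_lt (by fun_prop) continuous_const
      filter_upwards [self_mem_nhdsWithin, mem_nhdsWithin_of_mem_nhds (hopen.mem_nhds hn)]
        with t ht htn using (hne t ht htn).symm
    · exact hne s hs hn

lemma mul_sin_le_norm_mul_exp_add {R t δ χ : ℝ} (hR : 0 ≤ R) (ht : 0 ≤ t) (hδ₀ : 0 ≤ δ)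
    (hδ : δ ≤ π) (hχ : |χ| ≤ δ) :
    R * Real.sin δ ≤ ‖(t : ℂ) * Complex.exp (χ * Complex.I) + R‖ := by
  have hcos : Real.cos δ ≤ Real.cos χ := by
    rw [← Real.cos_abs χ]
    exact Real.cos_le_cos_of_nonneg_of_le_pi (abs_nonneg _) hδ hχ
  have hsin := Real.sin_nonneg_of_nonneg_of_le_pi hδ₀ hδ
  refine le_of_sq_le_sq ?_ (norm_nonneg _)
  rw [Complex.sq_norm, Complex.normSq_apply]
  simp only [Complex.add_re, Complex.re_ofReal_mul, Complex.exp_ofReal_mul_I_re,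
    Complex.ofReal_re, Complex.add_im, Complex.im_ofReal_mul, Complex.exp_ofReal_mul_I_im,
    Complex.ofReal_im, add_zero]
  have h₁ : (t * Real.cos χ + R) * (t * Real.cos χ + R) + t * Real.sin χ * (t * Real.sin χ) -
      (R * Real.sin δ) ^ 2 = (t + R * Real.cos δ) ^ 2 +
        2 * (t * R * (Real.cos χ - Real.cos δ)) := by
    linear_combination t ^ 2 * Real.sin_sq_add_cos_sq χ - R ^ 2 * Real.sin_sq_add_cos_sq δ
  have h₂ := mul_nonneg (mul_nonneg ht hR) (sub_nonneg.2 hcos)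
  have h₃ := sq_nonneg (t + R * Real.cos δ)
  linarith

lemma mul_sin_le_norm_exp_sub {R δ θ a : ℝ} {v : ℂ} (hR : 0 ≤ R) (hδ₀ : 0 ≤ δ) (hδ : δ ≤ π)
    (hv : |a * v.im - (θ - π)| ≤ δ) :
    R * Real.sin δ ≤ ‖Complex.exp (a * v) - R * Complex.exp (Complex.I * θ)‖ := by
  refine (mul_sin_le_norm_mul_exp_add hR (Real.exp_pos (a * v.re)).le hδ₀ hδ hv).trans_eq ?_
  have h : Complex.exp (a * v) - R * Complex.exp (Complex.I * θ) =
      Complex.exp ((θ - π : ℝ) * Complex.I) * ((Real.exp (a * v.re) : ℂ) *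
        Complex.exp ((a * v.im - (θ - π) : ℝ) * Complex.I) + R) := by
    have h1 : Complex.exp (Complex.I * θ) = -Complex.exp ((θ - π : ℝ) * Complex.I) := by
      push_cast
      rw [sub_mul, Complex.exp_sub, Complex.exp_pi_mul_I, div_neg, div_one, neg_neg, mul_comm]
    have h2 : Complex.exp (a * v) = Complex.exp ((θ - π : ℝ) * Complex.I) *
        ((Real.exp (a * v.re) : ℂ) * Complex.exp ((a * v.im - (θ - π) : ℝ) * Complex.I)) := by
      rw [Complex.ofReal_exp, ← Complex.exp_add, ← Complex.exp_add]
      congr 1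
      conv_lhs => rw [← Complex.re_add_im v]
      push_cast
      ring
    rw [h1, h2]
    ring
  rw [h, norm_mul, Complex.norm_exp_ofReal_mul_I, one_mul]

lemma hasSum_integral_mul_pow {α : Type*} [MeasurableSpace α] {ν : Measure α} {g w : α → ℂ}
    (hg : Integrable g ν) (hw : AEStronglyMeasurable w ν) {q : ℝ} (hq : q < 1)
    (hwq : ∀ᵐ x ∂ν, ‖w x‖ ≤ q) :
    HasSum (fun k : ℕ => ∫ x, g x * w x ^ k ∂ν) (∫ x, g x * (1 - w x)⁻¹ ∂ν) := by
  rcases eq_or_ne ν 0 with rfl | hν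
  · simp
  have : NeZero ν := ⟨hν⟩
  have hq0 : 0 ≤ q := by
    obtain ⟨x, hx⟩ := hwq.exists
    exact (norm_nonneg _).trans hx
  refine hasSum_integral_of_dominated_convergence (fun k x => ‖g x‖ * q ^ k)
    (fun k => hg.1.mul (hw.pow k)) (fun k => ?_)
    (ae_of_all _ fun x => (summable_geometric_of_lt_one hq0 hq).mul_left _) ?_ ?_
  · filter_upwards [hwq] with x hx
    rw [norm_mul, norm_pow]
    gcongr
  · simp_rw [tsum_mul_left]
    exact hg.norm.mul_const _
  · filter_upwards [hwq] with x hx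
    exact (hasSum_geometric_of_norm_lt_one (hx.trans_lt hq)).mul_left _

lemma hasSum_hankelContour_mul_pow {c b₁ b₂ q : ℝ} (hb : b₁ ≤ b₂) (hcos₁ : Real.cos b₁ < 0)
    (hcos₂ : Real.cos b₂ < 0) (s : ℂ) {w : ℂ → ℂ} (hw : Continuous w) (hq : q < 1)
    (hwq : ∀ v : ℂ, c ≤ v.re → ‖w v‖ ≤ q) :
    HasSum (fun k : ℕ => hankelContour c b₁ b₂ fun v => hankelKernel s v * w v ^ k)
      (hankelContour c b₁ b₂ fun v => hankelKernel s v * (1 - w v)⁻¹) := by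
  have hray (b : ℝ) (hcos : Real.cos b < 0) := hasSum_integral_mul_pow
    (integrableOn_Ioi_hankelKernel s hcos c)
    (w := fun x : ℝ => w (x + b * Complex.I)) (by fun_prop) hq (by
      filter_upwards [ae_restrict_mem measurableSet_Ioi] with x hx
      exact hwq _ (by simpa using (mem_Ioi.1 hx).le))
  have hseg := hasSum_integral_mul_pow (ν := volume.restrict (Ioc b₁ b₂))
    (g := fun y : ℝ => hankelKernel s (c + y * Complex.I))
    ((by fun_prop : Continuous _).integrableOn_Ioc)
    (w := fun y : ℝ => w (c + y * Complex.I)) (by fun_prop) hq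
    (ae_of_all _ fun y => hwq _ (by simp))
  simp only [hankelContour, integral_of_le hb]
  exact ((hray b₂ hcos₂).sub (hray b₁ hcos₁)).add (hseg.mul_left _)

lemma hankelContour_const_mul (c b₁ b₂ : ℝ) (m : ℂ) (f : ℂ → ℂ) :
    hankelContour c b₁ b₂ (fun v => m * f v) = m * hankelContour c b₁ b₂ f := by
  simp only [hankelContour, MeasureTheory.integral_const_mul, intervalIntegral.integral_const_mul]
  ring

/-- The Mittag-Leffler series as a Hankel contour integral. -/
lemma hankelContour_eq_ML {ρ c b₁ b₂ : ℝ} (hb : b₁ ≤ b₂)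
    (hb₁ : |b₁ + π| < π / 2) (hb₂ : |b₂ - π| < π / 2) (hcos₁ : Real.cos b₁ < 0)
    (hcos₂ : Real.cos b₂ < 0) (hρ : 0 < ρ) (μ z : ℂ) (hc : ‖z‖ < Real.exp (ρ⁻¹ * c)) :
    hankelContour c b₁ b₂ (fun v => hankelKernel (μ - (ρ⁻¹ : ℝ)) v *
      (Complex.exp ((ρ⁻¹ : ℝ) * v) - z)⁻¹) = 2 * π * Complex.I * ML ρ μ z := by
  set a := ρ⁻¹ with ha
  have h := hasSum_hankelContour_mul_pow (c := c) hb hcos₁ hcos₂ μ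
    (w := fun v => z * Complex.exp (-(a * v))) (by fun_prop)
    (q := ‖z‖ * Real.exp (-(a * c)))
    (by rwa [Real.exp_neg, ← div_eq_mul_inv, div_lt_one (Real.exp_pos _)])
    (fun v hv => by
      rw [norm_mul, Complex.norm_exp]
      have : 0 < a := inv_pos.2 hρ
      gcongr
      simp
      gcongr)
  have hterm (k : ℕ) : (fun v => hankelKernel μ v * (z * Complex.exp (-(a * v))) ^ k) =
      fun v => z ^ k * hankelKernel (μ + k / ρ) v := by
    funext v
    rw [mul_pow, ← Complex.exp_nat_mul, hankelKernel, hankelKernel, mul_left_comm,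
      ← Complex.exp_add, ha]
    push_cast
    ring_nf
  have hsum : (fun v => hankelKernel μ v * (1 - z * Complex.exp (-(a * v)))⁻¹) =
      fun v => hankelKernel (μ - a) v * (Complex.exp (a * v) - z)⁻¹ := by
    funext v
    have h1 : 1 - z * Complex.exp (-(a * v)) =
        Complex.exp (-(a * v)) * (Complex.exp (a * v) - z) := by
      rw [mul_sub, ← Complex.exp_add, neg_add_cancel, Complex.exp_zero, mul_comm z]
    rw [h1, mul_inv, ← mul_assoc, Complex.exp_neg, inv_inv]
    congr 1
    rw [hankelKernel, hankelKernel, ← Complex.exp_add]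
    ring_nf
  simp only [hterm, hsum, hankelContour_const_mul] at h
  rw [ML, ← tsum_mul_left, ← h.tsum_eq]
  congr 1 with k
  rw [hankelContour_hankelKernel _ hb₁ hb₂ hcos₁ hcos₂]
  ring

/-- On the ray of angle `θ - π + φ`, the contour integrand in terms of the phase `etaF`. -/
lemma hankelKernel_mul_inv_ray {ρ R : ℝ} (hρ : 0 < ρ) (hR : 0 < R) (μ : ℂ) (θ x φ : ℝ) :
    let r := Real.exp (ρ⁻¹ * x + -Real.log R)
    let L : ℂ := (Real.log (R * r) : ℂ) + Complex.I * ((θ - π : ℝ) : ℂ)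
    hankelKernel (μ - (ρ⁻¹ : ℝ)) (x + (ρ * (θ - π + φ) : ℝ) * Complex.I) *
      (Complex.exp ((ρ⁻¹ : ℝ) * (x + (ρ * (θ - π + φ) : ℝ) * Complex.I)) -
        R * Complex.exp (Complex.I * θ))⁻¹ =
      Complex.exp (ρ * (1 - μ) * L) *
        Complex.exp (Complex.exp (ρ * L) * Complex.cos (ρ * φ)) *
        Complex.exp (etaF ρ μ R θ r φ * Complex.I) *
        (r * Complex.exp (φ * Complex.I) * (r * Complex.exp (φ * Complex.I) + 1)⁻¹) := by
  intro r L
  have hρ' : (ρ : ℂ) ≠ 0 := by exact_mod_cast hρ.ne'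
  have hlog : Real.log (R * r) = ρ⁻¹ * x := by
    rw [Real.log_mul hR.ne' (Real.exp_pos _).ne', Real.log_exp]
    ring
  have hRr : R * r = Real.exp (ρ⁻¹ * x) := by
    rw [← hlog, Real.exp_log (mul_pos hR (Real.exp_pos _))]
  have hv : (x : ℂ) + (ρ * (θ - π + φ) : ℝ) * Complex.I = ρ * (L + φ * Complex.I) := by
    simp only [L, hlog]
    push_cast
    field_simp
    ring
  have hav : ((ρ⁻¹ : ℝ) : ℂ) * (ρ * (L + φ * Complex.I)) = L + φ * Complex.I := by
    push_cast
    field_simp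
  have hL : Complex.exp L = R * r * Complex.exp (Complex.I * ((θ - π : ℝ) : ℂ)) := by
    simp only [L, hlog]
    rw [Complex.exp_add, ← Complex.ofReal_exp, ← hRr, Complex.ofReal_mul]
  have hz : Complex.exp (Complex.I * θ) = -Complex.exp (Complex.I * ((θ - π : ℝ) : ℂ)) := by
    push_cast
    rw [mul_sub, Complex.exp_sub, mul_comm _ (π : ℂ), Complex.exp_pi_mul_I, div_neg, div_one,
      neg_neg]
  set E := Complex.exp (Complex.I * ((θ - π : ℝ) : ℂ))
  have hE0 : E ≠ 0 := Complex.exp_ne_zero _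
  have hR0 : (R : ℂ) ≠ 0 := by exact_mod_cast hR.ne'
  have hden : Complex.exp (L + φ * Complex.I) - R * Complex.exp (Complex.I * θ) =
      (R * E) * (r * Complex.exp (φ * Complex.I) + 1) := by
    rw [Complex.exp_add, hL, hz]
    ring
  have hker : hankelKernel (μ - (ρ⁻¹ : ℝ)) (ρ * (L + φ * Complex.I)) =
      Complex.exp (ρ * (1 - μ) * L) *
        Complex.exp (Complex.exp (ρ * L) * Complex.cos (ρ * φ)) *
        Complex.exp (etaF ρ μ R θ r φ * Complex.I) *
        (Complex.exp L * Complex.exp (φ * Complex.I)) := by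
    have h1 : Complex.exp (ρ * (L + φ * Complex.I)) =
        Complex.exp (ρ * L) * (Complex.cos (ρ * φ) + Complex.sin (ρ * φ) * Complex.I) := by
      rw [← Complex.exp_mul_I, ← Complex.exp_add]
      ring_nf
    rw [hankelKernel, h1, ← Complex.exp_add, ← Complex.exp_add, ← Complex.exp_add,
      ← Complex.exp_add, etaF]
    congr 1
    rw [show (1 - (μ - ((ρ⁻¹ : ℝ) : ℂ))) * (ρ * (L + φ * Complex.I)) =
      (1 - μ) * (ρ * (L + φ * Complex.I)) + (L + φ * Complex.I) by
        linear_combination hav]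
    ring
  rw [hv, hav, hden, hker, hL, mul_inv]
  field_simp

lemma smul_KsymF_eq {ρ R δ : ℝ} (hρ : 0 < ρ) (hR : 0 < R) (hδ₀ : 0 < δ) (hδ : δ < π)
    (μ : ℂ) (θ x : ℝ) :
    (ρ⁻¹ * Real.exp (ρ⁻¹ * x + -Real.log R)) •
        KsymF ρ μ R θ (Real.exp (ρ⁻¹ * x + -Real.log R)) δ =
      (2 * π * Complex.I)⁻¹ *
      (hankelKernel (μ - (ρ⁻¹ : ℝ)) (x + (ρ * (θ - π + δ) : ℝ) * Complex.I) *
        (Complex.exp ((ρ⁻¹ : ℝ) * (x + (ρ * (θ - π + δ) : ℝ) * Complex.I)) -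
          R * Complex.exp (Complex.I * θ))⁻¹ -
      hankelKernel (μ - (ρ⁻¹ : ℝ)) (x + (ρ * (θ - π + -δ) : ℝ) * Complex.I) *
        (Complex.exp ((ρ⁻¹ : ℝ) * (x + (ρ * (θ - π + -δ) : ℝ) * Complex.I)) -
          R * Complex.exp (Complex.I * θ))⁻¹) := by
  rw [hankelKernel_mul_inv_ray hρ hR, hankelKernel_mul_inv_ray hρ hR, Complex.real_smul, KsymF]
  set r := Real.exp (ρ⁻¹ * x + -Real.log R)
  have hη : etaF ρ μ R θ r (-δ) = -etaF ρ μ R θ r δ := by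
    simp only [etaF, Complex.ofReal_neg, mul_neg, Complex.sin_neg]
    ring
  have hne (χ : ℝ) (hχ : |χ| ≤ δ) : (r : ℂ) * Complex.exp (χ * Complex.I) + 1 ≠ 0 := by
    have h := mul_sin_le_norm_mul_exp_add zero_le_one (Real.exp_pos (ρ⁻¹ * x + -Real.log R)).le
      hδ₀.le hδ.le hχ
    rw [one_mul, Complex.ofReal_one] at h
    exact norm_pos_iff.1 ((Real.sin_pos_of_pos_of_lt_pi hδ₀ hδ).trans_le h)
  have h₁ := hne δ (abs_of_pos hδ₀).le
  have h₂ := hne (-δ) (by rw [abs_neg, abs_of_pos hδ₀])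
  have hd : Complex.exp (δ * Complex.I) * Complex.exp (-δ * Complex.I) = 1 := by
    rw [← Complex.exp_add, ← add_mul, add_neg_cancel, zero_mul, Complex.exp_zero]
  have hρ' : (ρ : ℂ) ≠ 0 := by exact_mod_cast hρ.ne'
  have hπ : (π : ℂ) ≠ 0 := by exact_mod_cast Real.pi_ne_zero
  rw [hη]
  simp only [Complex.ofReal_neg, mul_neg, Complex.cos_neg] at h₂ ⊢
  have hden : ((r ^ 2 + 2 * r * Real.cos δ + 1 : ℝ) : ℂ) =
      (r * Complex.exp (δ * Complex.I) + 1) * (r * Complex.exp (-δ * Complex.I) + 1) := by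
    push_cast
    rw [Complex.cos]
    linear_combination -(r : ℂ) ^ 2 * hd
  have hnum : (r : ℂ) * Complex.sin (etaF ρ μ R θ r δ) + Complex.sin (etaF ρ μ R θ r δ + δ) =
      (Complex.exp (etaF ρ μ R θ r δ * Complex.I) * Complex.exp (δ * Complex.I) *
          (r * Complex.exp (-δ * Complex.I) + 1) -
        Complex.exp (-etaF ρ μ R θ r δ * Complex.I) * Complex.exp (-δ * Complex.I) *
          (r * Complex.exp (δ * Complex.I) + 1)) / (2 * Complex.I) := by
    rw [Complex.sin, Complex.sin, neg_add, add_mul, add_mul, Complex.exp_add, Complex.exp_add,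
      eq_div_iff (by simp)]
    generalize Complex.exp (-etaF ρ μ R θ r δ * Complex.I) = p at *
    generalize Complex.exp (etaF ρ μ R θ r δ * Complex.I) = q at *
    generalize Complex.exp (δ * Complex.I) = d at *
    generalize Complex.exp (-δ * Complex.I) = d' at *
    linear_combination (r * (p - q) + p * d' - q * d) * Complex.I_sq + r * (p - q) * hd
  rw [hden, hnum]
  push_cast
  generalize Complex.exp (δ * Complex.I) = d at *
  generalize Complex.exp (-δ * Complex.I) = d' at *
  field_simp

/-- Corollary 3, item 1: representation "B" with the symmetric kernel. -/
theorem mittagLeffler_repr_B_sym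
    (ρ δρ R θ : ℝ) (μ : ℂ)
    (hρ : 1 / 2 < ρ) (hμ : μ.re < 1 + 1 / ρ)
    (hδ : (1 < ρ ∧ π / (2 * ρ) < δρ ∧ δρ ≤ π / ρ) ∨
          (ρ ≤ 1 ∧ π / (2 * ρ) < δρ ∧ δρ < π))
    (hR : 0 < R)
    (hθl : π / (2 * ρ) - δρ + π < θ) (hθu : θ < -(π / (2 * ρ)) + δρ + π) :
    ML ρ μ ((R : ℂ) * Complex.exp (Complex.I * (θ : ℂ))) =
      ∫ r in Set.Ioi (0 : ℝ), KsymF ρ μ R θ r δρ := by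
  have hρ0 : 0 < ρ := by linarith
  have hπ := Real.pi_pos
  have hδ₀ : 0 < δρ := by
    have : 0 < π / (2 * ρ) := by positivity
    rcases hδ with h | h <;> linarith
  have hδπ : δρ < π := by
    rcases hδ with h | h
    · exact h.2.2.trans_lt (div_lt_self hπ h.1)
    · exact h.2.2
  have hρδ : ρ * δρ ≤ π := by
    rcases hδ with h | h
    · rw [mul_comm]
      exact (le_div_iff₀ hρ0).1 h.2.2
    · nlinarith
  have hhalf : ρ * (π / (2 * ρ)) = π / 2 := by field_simp
  set b₁ := ρ * (θ - π + -δρ)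
  set b₂ := ρ * (θ - π + δρ)
  have hl := mul_lt_mul_of_pos_left hθl hρ0
  have hu := mul_lt_mul_of_pos_left hθu hρ0
  have hb₁ : |b₁ + π| < π / 2 := by
    rw [abs_lt]
    constructor <;> nlinarith
  have hb₂ : |b₂ - π| < π / 2 := by
    rw [abs_lt]
    constructor <;> nlinarith
  have hcos₁ : Real.cos b₁ < 0 := by
    rw [← neg_pos, ← Real.cos_add_pi]
    exact Real.cos_pos_of_mem_Ioo (abs_lt.1 hb₁)
  have hcos₂ : Real.cos b₂ < 0 := by
    rw [← neg_pos, ← Real.cos_sub_pi]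
    exact Real.cos_pos_of_mem_Ioo (abs_lt.1 hb₂)
  have hb : b₁ ≤ b₂ := mul_le_mul_of_nonneg_left (by linarith) hρ0.le
  set z : ℂ := R * Complex.exp (Complex.I * θ) with hz
  have hpos : 0 < R * Real.sin δρ := mul_pos hR (Real.sin_pos_of_pos_of_lt_pi hδ₀ hδπ)
  have hstrip (v : ℂ) (hv : v.im ∈ uIcc b₁ b₂) :
      R * Real.sin δρ ≤ ‖Complex.exp ((ρ⁻¹ : ℝ) * v) - z‖ := by
    refine mul_sin_le_norm_exp_sub hR.le hδ₀.le hδπ.le ?_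
    rw [uIcc_of_le hb] at hv
    have hy : ρ * (ρ⁻¹ * v.im) = v.im := mul_inv_cancel_left₀ hρ0.ne' _
    rw [abs_le]
    constructor
    · refine le_of_mul_le_mul_left ?_ hρ0
      linarith [hv.1]
    · refine le_of_mul_le_mul_left ?_ hρ0
      linarith [hv.2]
  have hcontour := hankelContour_eq_ML (c := ρ * (Real.log R + 1)) hb hb₁ hb₂ hcos₁ hcos₂ hρ0 μ z
    (by
      rw [inv_mul_cancel_left₀ hρ0.ne', Real.exp_add, Real.exp_log hR, hz, norm_mul, mul_comm
        Complex.I, Complex.norm_exp_ofReal_mul_I, Complex.norm_of_nonneg hR.le, mul_one]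
      exact lt_mul_of_one_lt_right hR (Real.one_lt_exp_iff.2 one_pos))
  have hs : (μ - ((ρ⁻¹ : ℝ) : ℂ)).re < 1 := by
    rw [Complex.sub_re, Complex.ofReal_re]
    rw [one_div] at hμ
    linarith
  have hB : DifferentiableOn ℂ (fun v : ℂ => (Complex.exp ((ρ⁻¹ : ℝ) * v) - z)⁻¹)
      {v | v.im ∈ uIcc b₁ b₂} :=
    DifferentiableOn.inv (by fun_prop) fun v hv =>
      norm_pos_iff.1 (hpos.trans_le (hstrip v hv))
  have hM (v : ℂ) (hv : v.im ∈ uIcc b₁ b₂) :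
      ‖(Complex.exp ((ρ⁻¹ : ℝ) * v) - z)⁻¹‖ ≤ (R * Real.sin δρ)⁻¹ := by
    rw [norm_inv]
    exact inv_anti₀ hpos (hstrip v hv)
  rw [hankelContour_eq_integral_sub hs hcos₁ hcos₂ hB hM,
    ← MeasureTheory.integral_sub (integrable_hankelKernel_mul hs hB hM right_mem_uIcc hcos₂)
      (integrable_hankelKernel_mul hs hB hM left_mem_uIcc hcos₁)] at hcontour
  rw [integral_Ioi_eq_integral_exp_smul (inv_pos.2 hρ0) (-Real.log R)]
  simp_rw [smul_KsymF_eq hρ0 hR hδ₀ hδπ]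
  rw [MeasureTheory.integral_const_mul, hcontour, inv_mul_cancel_left₀ (by simp [Real.pi_ne_zero])]
end

section
/- Let ρ > 1 and let μ ∈ ℂ with Re μ < 1 + 1/ρ. Let z = R·exp(iθ) with R > 0 and π − π/(2ρ) < θ < π + π/(2ρ). Then E_{ρ,μ}(z) = ∫_{0}^{∞} K_{ρ,μ}(r, z) dr, where K_{ρ,μ}(r, z) := (ρ/π) · exp(ρ(1−μ)·(Real.log(R·r) + i(θ−π))) · exp(−exp(ρ·(Real.log(R·r) + i(θ−π)))) · [r·sin(π(1−μ)) + sin(π(1−μ) + π/ρ)] / (r² + 2r·cos(π/ρ) + 1). -/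
open scoped Real
open MeasureTheory intervalIntegral

open Complex (I)
open Set Filter Topology

/-- The difference of `F` between the upper and the lower boundary of the strip
`|Im w - c| ≤ π`, at real part `a`. -/
noncomputable def stripEdge (c : ℝ) (F : ℂ → ℂ) (a : ℝ) : ℂ :=
  F (a + ((c + π : ℝ) : ℂ) * I) - F (a + ((c - π : ℝ) : ℂ) * I)

/-- The integral of `F` along the vertical cross section of the strip at real part `a`. -/
noncomputable def stripSection (c : ℝ) (F : ℂ → ℂ) (a : ℝ) : ℂ :=
  I * ∫ y in (c - π)..(c + π), F (a + (y : ℂ) * I)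

/-- The integral of `F` over the Hankel contour of the strip `|Im w - c| ≤ π`, in logarithmic
coordinates: the lower boundary from `+∞` to real part `a`, the cross section there, and the
upper boundary back to `+∞`. -/
noncomputable def hankelLoop (c : ℝ) (F : ℂ → ℂ) (a : ℝ) : ℂ :=
  stripSection c F a + ∫ t in Ioi a, stripEdge c F t

lemma abs_im_sub_le_of_mem_uIcc {c y : ℝ} (hy : y ∈ uIcc (c - π) (c + π)) : |y - c| ≤ π := by
  rw [uIcc_of_le (by linarith [Real.pi_pos]), mem_Icc] at hy
  rw [abs_le]; constructor <;> linarith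

lemma abs_add_pi_sub (c : ℝ) : |c + π - c| ≤ π := by
  rw [add_sub_cancel_left, abs_of_pos Real.pi_pos]

lemma abs_sub_pi_sub (c : ℝ) : |c - π - c| ≤ π := by
  rw [sub_sub_cancel_left, abs_neg, abs_of_pos Real.pi_pos]

section Strip

variable {c : ℝ} {F G : ℂ → ℂ}

lemma continuous_horizontal (hF : ∀ w : ℂ, |w.im - c| ≤ π → DifferentiableAt ℂ F w) {y : ℝ}
    (hy : |y - c| ≤ π) : Continuous fun a : ℝ => F (a + (y : ℂ) * I) := by
  rw [continuous_iff_continuousAt]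
  intro a
  have h : ContinuousAt F (a + (y : ℂ) * I) := (hF _ (by simpa using hy)).continuousAt
  exact ContinuousAt.comp (f := fun a : ℝ => (a : ℂ) + (y : ℂ) * I) h
    (by fun_prop)

lemma continuousOn_vertical (hF : ∀ w : ℂ, |w.im - c| ≤ π → DifferentiableAt ℂ F w) (a : ℝ) :
    ContinuousOn (fun y : ℝ => F (a + (y : ℂ) * I)) (uIcc (c - π) (c + π)) := by
  intro y hy
  have h : ContinuousAt F (a + (y : ℂ) * I) :=
    (hF _ (by simpa using abs_im_sub_le_of_mem_uIcc hy)).continuousAt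
  exact (ContinuousAt.comp (f := fun y : ℝ => (a : ℂ) + (y : ℂ) * I) h
    (by fun_prop)).continuousWithinAt

lemma intervalIntegrable_vertical (hF : ∀ w : ℂ, |w.im - c| ≤ π → DifferentiableAt ℂ F w)
    (a : ℝ) : IntervalIntegrable (fun y : ℝ => F (a + (y : ℂ) * I)) volume (c - π) (c + π) :=
  (continuousOn_vertical hF a).intervalIntegrable

lemma stripSection_sub_stripSection
    (hF : ∀ w : ℂ, |w.im - c| ≤ π → DifferentiableAt ℂ F w) (a b : ℝ) :
    stripSection c F b - stripSection c F a = ∫ t in a..b, stripEdge c F t := by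
  have h := Complex.integral_boundary_rect_eq_zero_of_differentiableOn F
    (a + ((c - π : ℝ) : ℂ) * I) (b + ((c + π : ℝ) : ℂ) * I) (by
      intro w hw
      rw [Complex.mem_reProdIm] at hw
      refine (hF w (abs_im_sub_le_of_mem_uIcc ?_)).differentiableWithinAt
      simpa using hw.2)
  simp only [Complex.add_re, Complex.ofReal_re, Complex.re_ofReal_mul, Complex.I_re, mul_zero,
    add_zero, Complex.add_im, Complex.ofReal_im, Complex.im_ofReal_mul, Complex.I_im, mul_one,
    zero_add, smul_eq_mul] at h
  unfold stripSection stripEdge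
  rw [intervalIntegral.integral_sub
    ((continuous_horizontal hF (abs_add_pi_sub c)).intervalIntegrable _ _)
    ((continuous_horizontal hF (abs_sub_pi_sub c)).intervalIntegrable _ _)]
  linear_combination h

lemma hankelLoop_eq_of_tendsto
    (hF : ∀ w : ℂ, |w.im - c| ≤ π → DifferentiableAt ℂ F w)
    (hint : Integrable (stripEdge c F)) {L : ℂ}
    (hL : Tendsto (stripSection c F) atBot (𝓝 L)) (a : ℝ) :
    hankelLoop c F a = L + ∫ t, stripEdge c F t := by
  have h1 : Tendsto (fun b => stripSection c F b + ∫ t in b..a, stripEdge c F t) atBot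
      (𝓝 (L + ∫ t in Iic a, stripEdge c F t)) :=
    hL.add (intervalIntegral_tendsto_integral_Iic a hint.integrableOn tendsto_id)
  have h2 : ∀ b, stripSection c F b + ∫ t in b..a, stripEdge c F t = stripSection c F a := by
    intro b
    rw [← stripSection_sub_stripSection hF b a]; ring
  simp only [h2] at h1
  have h3 := tendsto_nhds_unique tendsto_const_nhds h1
  rw [hankelLoop, h3, add_assoc]
  congr 1
  exact intervalIntegral.integral_Iic_add_Ioi hint.integrableOn hint.integrableOn

lemma hankelLoop_add
    (hF : ∀ w : ℂ, |w.im - c| ≤ π → DifferentiableAt ℂ F w)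
    (hG : ∀ w : ℂ, |w.im - c| ≤ π → DifferentiableAt ℂ G w) {a : ℝ}
    (hFi : IntegrableOn (stripEdge c F) (Ioi a)) (hGi : IntegrableOn (stripEdge c G) (Ioi a)) :
    hankelLoop c (fun w => F w + G w) a = hankelLoop c F a + hankelLoop c G a := by
  have h1 : stripEdge c (fun w => F w + G w) = fun t => stripEdge c F t + stripEdge c G t := by
    funext t; simp only [stripEdge]; ring
  rw [hankelLoop, h1, integral_add hFi hGi, stripSection, intervalIntegral.integral_add
    (intervalIntegrable_vertical hF a) (intervalIntegrable_vertical hG a), hankelLoop, hankelLoop,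
    stripSection, stripSection]
  ring

lemma hankelLoop_const_mul (k : ℂ) (a : ℝ) :
    hankelLoop c (fun w => k * F w) a = k * hankelLoop c F a := by
  have h1 : stripEdge c (fun w => k * F w) = fun t => k * stripEdge c F t := by
    funext t; simp only [stripEdge]; ring
  rw [hankelLoop, h1, MeasureTheory.integral_const_mul, stripSection, intervalIntegral.integral_const_mul,
    hankelLoop, stripSection]
  ring

lemma hankelLoop_congr (h : ∀ w : ℂ, |w.im - c| ≤ π → F w = G w) (a : ℝ) :
    hankelLoop c F a = hankelLoop c G a := by
  have h1 : stripEdge c F = stripEdge c G := by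
    funext t
    rw [stripEdge, stripEdge, h _ (by simpa using abs_add_pi_sub c),
      h _ (by simpa using abs_sub_pi_sub c)]
  rw [hankelLoop, hankelLoop, h1, stripSection, stripSection]
  congr 2
  refine intervalIntegral.integral_congr fun y hy => h _ ?_
  simpa using abs_im_sub_le_of_mem_uIcc hy

lemma hankelLoop_deriv {G' : ℂ → ℂ} (hG : ∀ w, HasDerivAt G (G' w) w)
    (hG' : Differentiable ℂ G') {a : ℝ}
    (htop : IntegrableOn (stripEdge c G) (Ioi a)) (hint : IntegrableOn (stripEdge c G') (Ioi a)) :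
    hankelLoop c G' a = 0 := by
  have hd : ∀ y t : ℝ, HasDerivAt (fun t : ℝ => G (t + (y : ℂ) * I)) (G' (t + (y : ℂ) * I)) t := by
    intro y t
    have h := (hG (t + (y : ℂ) * I)).scomp t
      ((Complex.ofRealCLM.hasDerivAt (x := t)).add_const ((y : ℂ) * I))
    simpa [Function.comp_def] using h
  have he : ∀ t, HasDerivAt (stripEdge c G) (stripEdge c G' t) t :=
    fun t => (hd _ t).sub (hd _ t)
  have hlim : Tendsto (stripEdge c G) atTop (𝓝 0) :=
    tendsto_zero_of_hasDerivAt_of_integrableOn_Ioi (fun t _ => he t) hint htop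
  have hv : ∀ y : ℝ, HasDerivAt (fun y : ℝ => G (a + (y : ℂ) * I)) (I * G' (a + (y : ℂ) * I)) y := by
    intro y
    have h := (hG (a + (y : ℂ) * I)).scomp y
      (((Complex.ofRealCLM.hasDerivAt (x := y)).mul_const I).const_add (a : ℂ))
    simpa [Function.comp_def] using h
  rw [hankelLoop, integral_Ioi_of_hasDerivAt_of_tendsto' (fun t _ => he t) hint hlim,
    stripSection, ← intervalIntegral.integral_const_mul,
    intervalIntegral.integral_eq_sub_of_hasDerivAt (fun y _ => hv y)
      ((intervalIntegrable_vertical (fun w _ => hG' w) a).const_mul I), stripEdge]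
  ring

/-- The integral of `‖F‖` over the Hankel contour. -/
noncomputable def hankelNorm (c : ℝ) (F : ℂ → ℂ) (a : ℝ) : ℝ :=
  (∫ y in (c - π)..(c + π), ‖F (a + (y : ℂ) * I)‖) +
    ∫ t in Ioi a, (‖F (t + ((c + π : ℝ) : ℂ) * I)‖ + ‖F (t + ((c - π : ℝ) : ℂ) * I)‖)

lemma norm_hankelLoop_le
    (hF : ∀ w : ℂ, |w.im - c| ≤ π → DifferentiableAt ℂ F w) {a : ℝ}
    (hup : IntegrableOn (fun t : ℝ => F (t + ((c + π : ℝ) : ℂ) * I)) (Ioi a))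
    (hlow : IntegrableOn (fun t : ℝ => F (t + ((c - π : ℝ) : ℂ) * I)) (Ioi a))
    {q : ℝ} (hle : ∀ w : ℂ, a ≤ w.re → |w.im - c| ≤ π → ‖G w‖ ≤ q * ‖F w‖) :
    ‖hankelLoop c G a‖ ≤ q * hankelNorm c F a := by
  rw [hankelLoop, hankelNorm, mul_add]
  refine (norm_add_le _ _).trans (add_le_add ?_ ?_)
  · rw [stripSection, norm_mul, Complex.norm_I, one_mul, ← intervalIntegral.integral_const_mul]
    refine intervalIntegral.norm_integral_le_of_norm_le (by linarith [Real.pi_pos])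
      (Eventually.of_forall fun y hy => hle _ (by simp) ?_)
      ((intervalIntegrable_vertical hF a).norm.const_mul q)
    simpa using abs_im_sub_le_of_mem_uIcc (Ioc_subset_Icc_self.trans Icc_subset_uIcc hy)
  · rw [← MeasureTheory.integral_const_mul]
    refine norm_integral_le_of_norm_le
      ((hup.norm.add hlow.norm).const_mul q) ?_
    refine (ae_restrict_mem measurableSet_Ioi).mono fun t ht => ?_
    rw [mul_add]
    have ht' : a ≤ t := le_of_lt ht
    exact (norm_sub_le _ _).trans (add_le_add
      (hle _ (by simpa using ht') (by simpa using abs_add_pi_sub c))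
      (hle _ (by simpa using ht') (by simpa using abs_sub_pi_sub c)))

/-- Holomorphy on the strip `|Im w - c| ≤ π` together with a bound by a multiple of
`|exp (exp w)| * exp (σ * Re w)`. -/
structure HankelAdmissible (c σ : ℝ) (F : ℂ → ℂ) : Prop where
  differentiableAt : ∀ w : ℂ, |w.im - c| ≤ π → DifferentiableAt ℂ F w
  bound : ∃ M : ℝ, 0 ≤ M ∧ ∀ w : ℂ, |w.im - c| ≤ π →
    ‖F w‖ ≤ M * Real.exp (Real.exp w.re * Real.cos w.im + σ * w.re)

lemma integrable_exp_neg_exp_add {k σ : ℝ} (hk : 0 < k) (hσ : 0 < σ) :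
    Integrable fun t : ℝ => Real.exp (-(k * Real.exp t) + σ * t) := by
  have h := integrableOn_rpow_mul_exp_neg_mul_rpow (p := 1) (s := σ - 1) (b := k)
    (by linarith) one_pos hk
  have himg : Real.exp '' univ = Ioi 0 := by rw [image_univ, Real.range_exp]
  rw [← himg, integrableOn_image_iff_integrableOn_abs_deriv_smul MeasurableSet.univ
    (fun x _ => (Real.hasDerivAt_exp x).hasDerivWithinAt) Real.exp_injective.injOn,
    integrableOn_univ] at h
  refine h.congr (Eventually.of_forall fun t => ?_)
  simp only [smul_eq_mul, abs_of_pos (Real.exp_pos t), ← Real.exp_mul, Real.rpow_one,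
    ← Real.exp_add]
  ring_nf

lemma integrableOn_Ioi_exp_neg_exp_add {k : ℝ} (hk : 0 < k) (σ a : ℝ) :
    IntegrableOn (fun t : ℝ => Real.exp (-(k * Real.exp t) + σ * t)) (Ioi a) := by
  have h := ((integrable_exp_neg_exp_add hk (σ := |σ| + 1) (by positivity)).const_mul
    (Real.exp (-((|σ| + 1 - σ) * a)))).integrableOn (s := Ioi a)
  refine h.mono' (by fun_prop) ?_
  refine (ae_restrict_mem measurableSet_Ioi).mono fun t ht => ?_
  rw [Real.norm_eq_abs, Real.abs_exp, ← Real.exp_add, Real.exp_le_exp]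
  have h1 : 0 < |σ| + 1 - σ := by linarith [le_abs_self σ]
  nlinarith [mul_lt_mul_of_pos_left (mem_Ioi.1 ht) h1]

namespace HankelAdmissible

variable {σ y : ℝ}

lemma integrableOn_horizontal (h : HankelAdmissible c σ F) (hc : 0 < Real.cos c)
    (hy : |y - c| ≤ π) (hcos : Real.cos y = -Real.cos c) (a : ℝ) :
    IntegrableOn (fun t : ℝ => F (t + (y : ℂ) * I)) (Ioi a) := by
  obtain ⟨M, -, hM⟩ := h.bound
  refine ((integrableOn_Ioi_exp_neg_exp_add hc σ a).const_mul M).mono'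
    (continuous_horizontal h.differentiableAt hy).aestronglyMeasurable
    (Eventually.of_forall fun t => ?_)
  have := hM (t + (y : ℂ) * I) (by simpa using hy)
  simp only [Complex.add_re, Complex.ofReal_re, Complex.re_ofReal_mul, Complex.I_re, mul_zero,
    add_zero, Complex.add_im, Complex.ofReal_im, Complex.im_ofReal_mul, Complex.I_im, mul_one,
    zero_add, hcos] at this
  convert this using 4
  ring

lemma integrable_horizontal (h : HankelAdmissible c σ F) (hc : 0 < Real.cos c) (hσ : 0 < σ)
    (hy : |y - c| ≤ π) (hcos : Real.cos y = -Real.cos c) :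
    Integrable fun t : ℝ => F (t + (y : ℂ) * I) := by
  obtain ⟨M, -, hM⟩ := h.bound
  refine ((integrable_exp_neg_exp_add hc hσ).const_mul M).mono'
    (continuous_horizontal h.differentiableAt hy).aestronglyMeasurable
    (Eventually.of_forall fun t => ?_)
  have := hM (t + (y : ℂ) * I) (by simpa using hy)
  simp only [Complex.add_re, Complex.ofReal_re, Complex.re_ofReal_mul, Complex.I_re, mul_zero,
    add_zero, Complex.add_im, Complex.ofReal_im, Complex.im_ofReal_mul, Complex.I_im, mul_one,
    zero_add, hcos] at this
  convert this using 4
  ring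

lemma integrableOn_stripEdge (h : HankelAdmissible c σ F) (hc : 0 < Real.cos c) (a : ℝ) :
    IntegrableOn (stripEdge c F) (Ioi a) :=
  (h.integrableOn_horizontal hc (abs_add_pi_sub c) (Real.cos_add_pi c) a).sub
    (h.integrableOn_horizontal hc (abs_sub_pi_sub c) (Real.cos_sub_pi c) a)

lemma integrable_stripEdge (h : HankelAdmissible c σ F) (hc : 0 < Real.cos c) (hσ : 0 < σ) :
    Integrable (stripEdge c F) :=
  (h.integrable_horizontal hc hσ (abs_add_pi_sub c) (Real.cos_add_pi c)).sub
    (h.integrable_horizontal hc hσ (abs_sub_pi_sub c) (Real.cos_sub_pi c))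

lemma tendsto_stripSection (h : HankelAdmissible c σ F) (hσ : 0 < σ) :
    Tendsto (stripSection c F) atBot (𝓝 0) := by
  obtain ⟨M, hM0, hM⟩ := h.bound
  have hlim : Tendsto (fun a : ℝ => M * Real.exp (1 + σ * a) * |c + π - (c - π)|) atBot
      (𝓝 (M * 0 * |c + π - (c - π)|)) := by
    refine ((Real.tendsto_exp_atBot.comp ?_).const_mul M).mul_const _
    exact tendsto_atBot_add_const_left _ _ (tendsto_id.const_mul_atBot hσ)
  rw [mul_zero, zero_mul] at hlim
  refine squeeze_zero_norm' ?_ hlim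
  filter_upwards [eventually_le_atBot 0] with a ha
  rw [stripSection, norm_mul, Complex.norm_I, one_mul]
  refine intervalIntegral.norm_integral_le_of_norm_le_const fun y hy => ?_
  refine (hM _ ?_).trans ?_
  · simpa using abs_im_sub_le_of_mem_uIcc (uIoc_subset_uIcc hy)
  · have h1 : Real.exp a ≤ 1 := Real.exp_le_one_iff.2 ha
    have h2 : Real.exp a * Real.cos y ≤ 1 := by
      nlinarith [Real.cos_le_one y, Real.exp_pos a]
    simp only [Complex.add_re, Complex.ofReal_re, Complex.re_ofReal_mul, Complex.I_re, mul_zero,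
      add_zero, Complex.add_im, Complex.ofReal_im, Complex.im_ofReal_mul, Complex.I_im, mul_one,
      zero_add]
    gcongr

lemma hankelLoop_eq (h : HankelAdmissible c σ F) (hc : 0 < Real.cos c) (hσ : 0 < σ) (a : ℝ) :
    hankelLoop c F a = ∫ t, stripEdge c F t := by
  rw [hankelLoop_eq_of_tendsto h.differentiableAt (h.integrable_stripEdge hc hσ)
    (h.tendsto_stripSection hσ), zero_add]

end HankelAdmissible

end Strip

section Gamma

variable {c : ℝ}

/-- The integrand `exp ζ * ζ ^ (-s) dζ` of Hankel's formula for `1 / Γ(s)` at `ζ = exp w`. -/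
noncomputable def hankelExp (s w : ℂ) : ℂ := Complex.exp (Complex.exp w + (1 - s) * w)

lemma norm_hankelExp (s w : ℂ) : ‖hankelExp s w‖ =
    Real.exp (s.im * w.im) * Real.exp (Real.exp w.re * Real.cos w.im + (1 - s.re) * w.re) := by
  rw [hankelExp, Complex.norm_exp, ← Real.exp_add]
  congr 1
  simp only [Complex.add_re, Complex.exp_re, Complex.mul_re, Complex.sub_re, Complex.one_re,
    Complex.sub_im, Complex.one_im]
  ring

lemma norm_hankelExp_le {s w : ℂ} (hw : |w.im - c| ≤ π) : ‖hankelExp s w‖ ≤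
    Real.exp (|s.im| * (|c| + π)) *
      Real.exp (Real.exp w.re * Real.cos w.im + (1 - s.re) * w.re) := by
  have hy : |w.im| ≤ |c| + π :=
    calc |w.im| = |c + (w.im - c)| := by ring_nf
      _ ≤ |c| + |w.im - c| := abs_add_le _ _
      _ ≤ |c| + π := by gcongr
  have h : s.im * w.im ≤ |s.im| * (|c| + π) :=
    (le_abs_self _).trans (by rw [abs_mul]; gcongr)
  rw [norm_hankelExp]
  gcongr

lemma hasDerivAt_hankelExp (s w : ℂ) :
    HasDerivAt (hankelExp (s + 1)) (hankelExp s w + -s * hankelExp (s + 1) w) w := by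
  have h : HasDerivAt (fun w : ℂ => Complex.exp w + (1 - (s + 1)) * w)
      (Complex.exp w + (1 - (s + 1)) * 1) w :=
    (Complex.hasDerivAt_exp w).add ((hasDerivAt_id w).const_mul _)
  refine h.cexp.congr_deriv ?_
  have h1 : hankelExp s w = Complex.exp w * hankelExp (s + 1) w := by
    rw [hankelExp, hankelExp, ← Complex.exp_add]; ring_nf
  rw [h1, ← hankelExp]
  ring

lemma differentiable_hankelExp (s : ℂ) : Differentiable ℂ (hankelExp s) := by
  unfold hankelExp; fun_prop

lemma hankelAdmissible_hankelExp (c : ℝ) (s : ℂ) :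
    HankelAdmissible c (1 - s.re) (hankelExp s) where
  differentiableAt w _ := differentiable_hankelExp s w
  bound := ⟨_, (Real.exp_pos _).le, fun _ hw => norm_hankelExp_le hw⟩

lemma hankelExp_add_pi (s : ℂ) (c t : ℝ) :
    hankelExp s (t + ((c + π : ℝ) : ℂ) * I) =
      Complex.exp (-Complex.exp (t + c * I) + (1 - s) * (t + c * I)) *
        Complex.exp ((π * (1 - s)) * I) := by
  have h : (t : ℂ) + ((c + π : ℝ) : ℂ) * I = (t + c * I) + π * I := by push_cast; ring
  rw [h, hankelExp, Complex.exp_add_pi_mul_I, ← Complex.exp_add]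
  ring_nf

lemma hankelExp_sub_pi (s : ℂ) (c t : ℝ) :
    hankelExp s (t + ((c - π : ℝ) : ℂ) * I) =
      Complex.exp (-Complex.exp (t + c * I) + (1 - s) * (t + c * I)) *
        Complex.exp (-(π * (1 - s)) * I) := by
  have h : (t : ℂ) + ((c - π : ℝ) : ℂ) * I = (t + c * I) - π * I := by push_cast; ring
  rw [h, hankelExp, Complex.exp_sub_pi_mul_I, ← Complex.exp_add]
  ring_nf

lemma stripEdge_hankelExp (s : ℂ) (c t : ℝ) :
    stripEdge c (hankelExp s) t =
      2 * I * Complex.sin (π * s) *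
        Complex.exp (-Complex.exp (t + c * I) + (1 - s) * (t + c * I)) := by
  rw [stripEdge, hankelExp_add_pi, hankelExp_sub_pi]
  have h : Complex.sin (π * s) = Complex.sin (π * (1 - s)) := by
    rw [mul_sub, mul_one, Complex.sin_pi_sub]
  rw [h, Complex.sin]
  linear_combination (-(Complex.exp (-(π * (1 - s)) * I) - Complex.exp (π * (1 - s) * I)) *
    Complex.exp (-Complex.exp (t + c * I) + (1 - s) * (t + c * I))) * Complex.I_sq

lemma cos_pos_of_abs_lt (hc : |c| < π / 2) : 0 < Real.cos c :=
  Real.cos_pos_of_mem_Ioo ⟨by linarith [(abs_lt.1 hc).1], (abs_lt.1 hc).2⟩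

lemma tendsto_exp_neg_exp_add_atTop {k : ℝ} (hk : 0 < k) (σ : ℝ) :
    Tendsto (fun t : ℝ => Real.exp (-(k * Real.exp t) + σ * t)) atTop (𝓝 0) := by
  refine ((tendsto_rpow_mul_exp_neg_mul_atTop_nhds_zero σ k hk).comp
    Real.tendsto_exp_atTop).congr fun t => ?_
  rw [Function.comp_apply, ← Real.exp_mul, ← Real.exp_add]
  ring_nf

lemma tendsto_exp_neg_exp_add_atBot {k σ : ℝ} (hk : 0 < k) (hσ : 0 < σ) :
    Tendsto (fun t : ℝ => Real.exp (-(k * Real.exp t) + σ * t)) atBot (𝓝 0) := by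
  refine squeeze_zero (fun t => (Real.exp_pos _).le) (fun t => ?_)
    (Real.tendsto_exp_atBot.comp (tendsto_id.const_mul_atBot hσ))
  rw [Function.comp_apply, Real.exp_le_exp, id]
  nlinarith [mul_pos hk (Real.exp_pos t)]

lemma norm_exp_neg_exp_add_le (hc : |c| < π / 2) (s : ℂ) {y : ℝ} (hy : y ∈ uIcc 0 c) (t : ℝ) :
    ‖Complex.exp (-Complex.exp (t + y * I) + s * (t + y * I))‖ ≤
      Real.exp (|s.im| * |c|) * Real.exp (-(Real.cos c * Real.exp t) + s.re * t) := by
  have hyc : |y| ≤ |c| := by simpa using abs_sub_left_of_mem_uIcc hy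
  have h1 : Real.cos c ≤ Real.cos y := by
    rw [← Real.cos_abs c, ← Real.cos_abs y]
    exact Real.cos_le_cos_of_nonneg_of_le_pi (abs_nonneg _) (by linarith [Real.pi_pos]) hyc
  have h2 : -(s.im * y) ≤ |s.im| * |c| := by
    refine (neg_le_abs _).trans ?_
    rw [abs_mul]; gcongr
  rw [Complex.norm_exp, ← Real.exp_add, Real.exp_le_exp]
  have h3 := mul_le_mul_of_nonneg_right h1 (Real.exp_pos t).le
  simp [Complex.exp_re]
  linarith

lemma integral_exp_neg_exp_rotate (hc : |c| < π / 2) {s : ℂ} (hs : 0 < s.re) :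
    ∫ t : ℝ, Complex.exp (-Complex.exp (t + c * I) + s * (t + c * I)) =
      ∫ t : ℝ, Complex.exp (-Complex.exp t + s * t) := by
  set G : ℂ → ℂ := fun w => Complex.exp (-Complex.exp w + s * w) with hGdef
  have hG : Differentiable ℂ G := by fun_prop
  have hcos := cos_pos_of_abs_lt hc
  have hbound : ∀ y ∈ uIcc 0 c, ∀ t : ℝ, ‖G (t + y * I)‖ ≤
      Real.exp (|s.im| * |c|) * Real.exp (-(Real.cos c * Real.exp t) + s.re * t) :=
    fun y hy t => norm_exp_neg_exp_add_le hc s hy t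
  have hint : ∀ y ∈ uIcc 0 c, Integrable fun t : ℝ => G (t + y * I) := fun y hy =>
    ((integrable_exp_neg_exp_add hcos hs).const_mul _).mono'
      (by fun_prop) (Eventually.of_forall (hbound y hy))
  have hside : ∀ {l : Filter ℝ},
      Tendsto (fun t : ℝ => Real.exp (-(Real.cos c * Real.exp t) + s.re * t)) l (𝓝 0) →
      Tendsto (fun t : ℝ => ∫ y in (0 : ℝ)..c, G (t + y * I)) l (𝓝 0) := by
    intro l hl
    have h := (hl.const_mul (Real.exp (|s.im| * |c|))).mul_const |c - 0|
    rw [mul_zero, zero_mul] at h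
    exact squeeze_zero_norm (fun t => intervalIntegral.norm_integral_le_of_norm_le_const
      fun y hy => hbound y (uIoc_subset_uIcc hy) t) h
  have hrect : ∀ n : ℝ, (∫ x in -n..n, G x) - (∫ x in -n..n, G (x + c * I)) +
      I * (∫ y in (0 : ℝ)..c, G (n + y * I)) -
      I * (∫ y in (0 : ℝ)..c, G (((-n : ℝ) : ℂ) + y * I)) = 0 := by
    intro n
    have h := Complex.integral_boundary_rect_eq_zero_of_differentiableOn G
      ((-n : ℝ) : ℂ) (n + c * I) hG.differentiableOn
    simpa using h
  have h0 : Tendsto (fun n : ℝ => ∫ x in -n..n, G x) atTop (𝓝 (∫ x : ℝ, G x)) :=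
    intervalIntegral_tendsto_integral (by simpa using hint 0 left_mem_uIcc)
      tendsto_neg_atTop_atBot tendsto_id
  have h1 : Tendsto (fun n : ℝ => ∫ x in -n..n, G (x + c * I)) atTop
      (𝓝 (∫ x : ℝ, G (x + c * I))) :=
    intervalIntegral_tendsto_integral (hint c right_mem_uIcc) tendsto_neg_atTop_atBot tendsto_id
  have h2 := hside (tendsto_exp_neg_exp_add_atTop hcos s.re)
  have h3 := (hside (tendsto_exp_neg_exp_add_atBot hcos hs)).comp tendsto_neg_atTop_atBot
  have h4 := ((h0.sub h1).add (h2.const_mul I)).sub (h3.const_mul I)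
  simp only [Function.comp_apply, hrect] at h4
  have h5 := tendsto_nhds_unique tendsto_const_nhds h4
  linear_combination h5

lemma integral_exp_neg_exp_eq_Gamma (hc : |c| < π / 2) {s : ℂ} (hs : 0 < s.re) :
    ∫ t : ℝ, Complex.exp (-Complex.exp (t + c * I) + s * (t + c * I)) = Complex.Gamma s := by
  have himg : Real.exp '' univ = Ioi 0 := by rw [image_univ, Real.range_exp]
  rw [integral_exp_neg_exp_rotate hc hs, Complex.Gamma_eq_integral hs, Complex.GammaIntegral,
    ← himg, integral_image_eq_integral_abs_deriv_smul MeasurableSet.univ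
    (fun x _ => (Real.hasDerivAt_exp x).hasDerivWithinAt) Real.exp_injective.injOn,
    setIntegral_univ]
  congr 1
  funext t
  rw [abs_of_pos (Real.exp_pos t), Complex.real_smul, Complex.cpow_def_of_ne_zero
    (by exact_mod_cast (Real.exp_pos t).ne'), ← Complex.ofReal_log (Real.exp_pos t).le,
    Real.log_exp]
  push_cast
  rw [← Complex.exp_add, ← Complex.exp_add]
  ring_nf

lemma inv_Gamma_eq {s : ℂ} (hs : s.re < 1) :
    (Complex.Gamma s)⁻¹ = Complex.sin (π * s) * Complex.Gamma (1 - s) / π := by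
  have hG : Complex.Gamma (1 - s) ≠ 0 := Complex.Gamma_ne_zero_of_re_pos (by simpa using hs)
  have h := Complex.Gamma_mul_Gamma_one_sub s
  have hpi : (π : ℂ) ≠ 0 := by exact_mod_cast Real.pi_ne_zero
  by_cases hsin : Complex.sin (π * s) = 0
  · rw [hsin, div_zero, mul_eq_zero, or_iff_left hG] at h
    simp [h, hsin]
  · have hs0 : Complex.Gamma s ≠ 0 := by
      intro h0
      rw [h0, zero_mul] at h
      exact div_ne_zero hpi hsin h.symm
    rw [eq_div_iff hsin] at h
    field_simp
    linear_combination -h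

lemma hankelLoop_hankelExp_of_re_lt (hc : |c| < π / 2) {s : ℂ} (hs : s.re < 1) (a : ℝ) :
    hankelLoop c (hankelExp s) a = 2 * π * I * (Complex.Gamma s)⁻¹ := by
  rw [(hankelAdmissible_hankelExp c s).hankelLoop_eq (cos_pos_of_abs_lt hc) (by linarith)]
  simp only [stripEdge_hankelExp]
  rw [MeasureTheory.integral_const_mul,
    integral_exp_neg_exp_eq_Gamma hc (by simpa using hs), inv_Gamma_eq hs]
  have hpi : (π : ℂ) ≠ 0 := by exact_mod_cast Real.pi_ne_zero
  field_simp

lemma hankelLoop_hankelExp_add_one (hc : |c| < π / 2) (s : ℂ) (a : ℝ) :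
    hankelLoop c (hankelExp s) a = s * hankelLoop c (hankelExp (s + 1)) a := by
  have hcos := cos_pos_of_abs_lt hc
  have h0 := (hankelAdmissible_hankelExp c s).integrableOn_stripEdge hcos a
  have h1 := (hankelAdmissible_hankelExp c (s + 1)).integrableOn_stripEdge hcos a
  have h2 : IntegrableOn (stripEdge c fun w => -s * hankelExp (s + 1) w) (Ioi a) := by
    refine (h1.const_mul (-s)).congr (Eventually.of_forall fun t => ?_)
    simp only [stripEdge]; ring
  have hd : Differentiable ℂ fun w => -s * hankelExp (s + 1) w :=
    (differentiable_hankelExp _).const_mul _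
  have h3 : IntegrableOn (stripEdge c fun w => hankelExp s w + -s * hankelExp (s + 1) w)
      (Ioi a) := by
    refine (h0.add h2).congr (Eventually.of_forall fun t => ?_)
    simp only [stripEdge, Pi.add_apply]; ring
  have h4 := hankelLoop_deriv (hasDerivAt_hankelExp s) ((differentiable_hankelExp s).add hd) h1 h3
  rw [hankelLoop_add (fun w _ => differentiable_hankelExp s w) (fun w _ => hd w) h0 h2,
    hankelLoop_const_mul] at h4
  linear_combination h4

lemma hankelLoop_hankelExp_one (c a : ℝ) : hankelLoop c (hankelExp 1) a = 2 * π * I := by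
  have hedge : stripEdge c (hankelExp 1) = 0 := by
    funext t
    rw [stripEdge_hankelExp, mul_one, Complex.sin_pi, mul_zero, zero_mul, Pi.zero_apply]
  have hL : Tendsto (stripSection c (hankelExp 1)) atBot
      (𝓝 (I * ∫ _ in (c - π)..(c + π), (1 : ℂ))) := by
    refine Tendsto.const_mul I ?_
    refine intervalIntegral.tendsto_integral_filter_of_dominated_convergence
      (fun _ => Real.exp 1) ?_ ?_ intervalIntegrable_const ?_
    · refine Eventually.of_forall fun t => Continuous.aestronglyMeasurable ?_
      unfold hankelExp; fun_prop
    · filter_upwards [eventually_le_atBot 0] with t ht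
      refine Eventually.of_forall fun y _ => ?_
      have h1 : Real.exp t ≤ 1 := Real.exp_le_one_iff.2 ht
      rw [norm_hankelExp]
      simp only [Complex.one_im, Complex.one_re, zero_mul, Real.exp_zero, one_mul, sub_self,
        add_zero]
      rw [Real.exp_le_exp]
      simp
      nlinarith [Real.cos_le_one y, Real.exp_pos t]
    · refine Eventually.of_forall fun y _ => ?_
      have h1 : Tendsto (fun t : ℝ => Complex.exp (t + (y : ℂ) * I)) atBot (𝓝 0) := by
        rw [tendsto_zero_iff_norm_tendsto_zero]
        simpa [Complex.norm_exp] using Real.tendsto_exp_atBot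
      simpa [hankelExp, Function.comp_def] using (Complex.continuous_exp.tendsto 0).comp h1
  rw [hankelLoop_eq_of_tendsto (fun w _ => differentiable_hankelExp 1 w)
    (by rw [hedge]; exact integrable_zero _ _ _) hL, hedge]
  simp
  ring

/-- Hankel's formula for `1 / Γ(s)`. -/
lemma hankelLoop_hankelExp (hc : |c| < π / 2) (s : ℂ) (a : ℝ) :
    hankelLoop c (hankelExp s) a = 2 * π * I * (Complex.Gamma s)⁻¹ := by
  obtain ⟨n, hn⟩ := exists_nat_gt (s.re - 1)
  induction n generalizing s with
  | zero => exact hankelLoop_hankelExp_of_re_lt hc (by simpa using hn) a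
  | succ n ih =>
    obtain rfl | hs := eq_or_ne s 1
    · rw [hankelLoop_hankelExp_one, Complex.Gamma_one, inv_one, mul_one]
    have hs' : s - 1 ≠ 0 := sub_ne_zero.2 hs
    have h1 := ih (s - 1) (by push_cast at hn; simp; linarith)
    rw [hankelLoop_hankelExp_add_one hc, sub_add_cancel] at h1
    have h2 := Complex.Gamma_add_one (s - 1) hs'
    rw [sub_add_cancel] at h2
    rw [h2, mul_inv]
    field_simp
    linear_combination h1

end Gamma

section MittagLeffler

/-- The integrand `exp ζ * ζ ^ (-s) / (1 + x * ζ ^ (-1 / ρ)) dζ` of the Hankel representation of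
the Mittag-Leffler function at `-x`, where `ζ = exp w`. -/
noncomputable def mlIntegrand (ρ : ℝ) (x s w : ℂ) : ℂ :=
  hankelExp s w / (1 + x * Complex.exp (-w / ρ))

variable {ρ r c : ℝ} {x : ℂ}

lemma one_add_mul_cos_half_le_norm (t φ : ℝ) :
    (1 + t) * Real.cos (φ / 2) ≤ ‖1 + (t : ℂ) * Complex.exp (φ * I)‖ := by
  have h : Complex.exp ((-(φ / 2) : ℝ) * I) * (1 + (t : ℂ) * Complex.exp (φ * I)) =
      Complex.exp ((-(φ / 2) : ℝ) * I) + t * Complex.exp ((φ / 2 : ℝ) * I) := by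
    rw [mul_add, mul_one, mul_left_comm, ← Complex.exp_add]
    push_cast
    ring_nf
  calc (1 + t) * Real.cos (φ / 2)
      = (Complex.exp ((-(φ / 2) : ℝ) * I) * (1 + (t : ℂ) * Complex.exp (φ * I))).re := by
        rw [h, Complex.add_re, Complex.re_ofReal_mul, Complex.exp_ofReal_mul_I_re,
          Complex.exp_ofReal_mul_I_re, Real.cos_neg]
        ring
    _ ≤ _ := Complex.re_le_norm _
    _ = _ := by rw [norm_mul, Complex.norm_exp_ofReal_mul_I, one_mul]

lemma cos_pi_div_two_mul_pos (hρ : 1 < ρ) : 0 < Real.cos (π / ρ / 2) := by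
  have h : π / ρ < π := div_lt_self Real.pi_pos hρ
  have h0 : 0 < π / ρ := by have := Real.pi_pos; positivity
  exact Real.cos_pos_of_mem_Ioo ⟨by linarith, by linarith⟩

lemma le_norm_mlDenominator (hρ : 1 < ρ) (hr : 0 ≤ r)
    (hx : x = r * Complex.exp ((c / ρ : ℝ) * I)) {w : ℂ} (hw : |w.im - c| ≤ π) :
    Real.cos (π / ρ / 2) * (1 + r * Real.exp (-w.re / ρ)) ≤
      ‖1 + x * Complex.exp (-w / ρ)‖ := by
  have hρ0 : 0 < ρ := by linarith
  have h : x * Complex.exp (-w / ρ) =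
      ((r * Real.exp (-w.re / ρ) : ℝ) : ℂ) * Complex.exp (((c - w.im) / ρ : ℝ) * I) := by
    rw [hx]
    push_cast
    rw [mul_assoc, mul_assoc, ← Complex.exp_add, ← Complex.exp_add]
    congr 2
    conv_lhs => rw [← Complex.re_add_im w]
    ring
  rw [h]
  refine le_trans ?_ (one_add_mul_cos_half_le_norm _ _)
  rw [mul_comm]
  have h1 : |(c - w.im) / ρ / 2| ≤ π / ρ / 2 := by
    rw [abs_div, abs_div, abs_of_pos hρ0, abs_two, abs_sub_comm]
    gcongr
  have h2 : π / ρ < π := div_lt_self Real.pi_pos hρ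
  have h3 : Real.cos (π / ρ / 2) ≤ Real.cos ((c - w.im) / ρ / 2) := by
    rw [← Real.cos_abs ((c - w.im) / ρ / 2)]
    exact Real.cos_le_cos_of_nonneg_of_le_pi (abs_nonneg _) (by linarith [Real.pi_pos]) h1
  gcongr

lemma mlDenominator_ne_zero (hρ : 1 < ρ) (hr : 0 ≤ r)
    (hx : x = r * Complex.exp ((c / ρ : ℝ) * I)) {w : ℂ} (hw : |w.im - c| ≤ π) :
    1 + x * Complex.exp (-w / ρ) ≠ 0 := by
  rw [← norm_pos_iff]
  have := cos_pi_div_two_mul_pos hρ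
  exact lt_of_lt_of_le (by positivity) (le_norm_mlDenominator hρ hr hx hw)

lemma differentiableAt_mlIntegrand (hρ : 1 < ρ) (hr : 0 ≤ r)
    (hx : x = r * Complex.exp ((c / ρ : ℝ) * I)) (s : ℂ) {w : ℂ} (hw : |w.im - c| ≤ π) :
    DifferentiableAt ℂ (mlIntegrand ρ x s) w :=
  (differentiable_hankelExp s w).div (by fun_prop) (mlDenominator_ne_zero hρ hr hx hw)

lemma hankelAdmissible_mlIntegrand (hρ : 1 < ρ) (hr : 0 ≤ r)
    (hx : x = r * Complex.exp ((c / ρ : ℝ) * I)) (s : ℂ) :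
    HankelAdmissible c (1 - s.re) (mlIntegrand ρ x s) where
  differentiableAt _ hw := differentiableAt_mlIntegrand hρ hr hx s hw
  bound := by
    have hm := cos_pi_div_two_mul_pos hρ
    refine ⟨Real.exp (|s.im| * (|c| + π)) / Real.cos (π / ρ / 2), by positivity,
      fun w hw => ?_⟩
    rw [mlIntegrand, norm_div, div_mul_eq_mul_div]
    refine div_le_div₀ (by positivity) (norm_hankelExp_le hw) hm
      (le_trans ?_ (le_norm_mlDenominator hρ hr hx hw))
    exact le_mul_of_one_le_right hm.le (le_add_of_nonneg_right (by positivity))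

lemma hankelAdmissible_mlIntegrand_of_pos (hρ : 1 < ρ) (hr : 0 < r)
    (hx : x = r * Complex.exp ((c / ρ : ℝ) * I)) (s : ℂ) :
    HankelAdmissible c (1 - s.re + 1 / ρ) (mlIntegrand ρ x s) where
  differentiableAt _ hw := differentiableAt_mlIntegrand hρ hr.le hx s hw
  bound := by
    have hm := cos_pi_div_two_mul_pos hρ
    refine ⟨Real.exp (|s.im| * (|c| + π)) / (Real.cos (π / ρ / 2) * r), by positivity,
      fun w hw => ?_⟩
    have h1 : Real.exp (Real.exp w.re * Real.cos w.im + (1 - s.re + 1 / ρ) * w.re) =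
        Real.exp (Real.exp w.re * Real.cos w.im + (1 - s.re) * w.re) /
          Real.exp (-w.re / ρ) := by
      rw [← Real.exp_sub]; ring_nf
    rw [mlIntegrand, norm_div, h1, div_mul_div_comm]
    refine div_le_div₀ (by positivity) (norm_hankelExp_le hw) (by positivity)
      (le_trans ?_ (le_norm_mlDenominator hρ hr.le hx hw))
    rw [mul_assoc]
    gcongr
    linarith

lemma hankelExp_add (s t w : ℂ) :
    hankelExp (s + t) w = hankelExp s w * Complex.exp (-(t * w)) := by
  rw [hankelExp, hankelExp, ← Complex.exp_add]; ring_nf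

lemma hankelLoop_mlIntegrand_add (hρ : 1 < ρ) (hr : 0 ≤ r)
    (hx : x = r * Complex.exp ((c / ρ : ℝ) * I)) (hc : |c| < π / 2) (s : ℂ) (a : ℝ) :
    hankelLoop c (mlIntegrand ρ x s) a + x * hankelLoop c (mlIntegrand ρ x (s + 1 / ρ)) a =
      2 * π * I * (Complex.Gamma s)⁻¹ := by
  have hcos := cos_pos_of_abs_lt hc
  have h0 := hankelAdmissible_mlIntegrand hρ hr hx s
  have h1 := hankelAdmissible_mlIntegrand hρ hr hx (s + 1 / ρ)
  have h2 : IntegrableOn (stripEdge c fun w => x * mlIntegrand ρ x (s + 1 / ρ) w) (Ioi a) := by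
    refine ((h1.integrableOn_stripEdge hcos a).const_mul x).congr (Eventually.of_forall fun t => ?_)
    simp only [stripEdge]; ring
  rw [← hankelLoop_hankelExp hc s a, ← hankelLoop_const_mul, ← hankelLoop_add
    h0.differentiableAt (fun w hw => (h1.differentiableAt w hw).const_mul x)
    (h0.integrableOn_stripEdge hcos a) h2]
  refine hankelLoop_congr (fun w hw => ?_) a
  have hne := mlDenominator_ne_zero hρ hr hx hw
  have h3 : -(1 / (ρ : ℂ) * w) = -w / ρ := by ring
  rw [mlIntegrand, mlIntegrand, hankelExp_add, h3, mul_div_assoc', ← add_div,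
    div_eq_iff hne]
  ring

lemma norm_exp_neg_nat_div_mul_le (hρ : 0 < ρ) (n : ℕ) {a : ℝ} {w : ℂ} (hw : a ≤ w.re) :
    ‖Complex.exp (-((n : ℂ) / ρ * w))‖ ≤ Real.exp (-a / ρ) ^ n := by
  have h : ((n : ℂ) / ρ * w).re = n / ρ * w.re := by
    rw [← Complex.ofReal_natCast, ← Complex.ofReal_div, Complex.re_ofReal_mul]
  rw [Complex.norm_exp, ← Real.exp_nat_mul, Real.exp_le_exp, Complex.neg_re, h]
  have h1 : (n : ℝ) / ρ * a ≤ n / ρ * w.re := by gcongr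
  calc -(n / ρ * w.re) ≤ -(n / ρ * a) := neg_le_neg h1
    _ = n * (-a / ρ) := by ring

/-- The loop integral around the Hankel contour represents the Mittag-Leffler function. -/
lemma hankelLoop_mlIntegrand (hρ : 1 < ρ) (hr : 0 < r)
    (hx : x = r * Complex.exp ((c / ρ : ℝ) * I)) (hc : |c| < π / 2) (μ : ℂ) :
    ∃ a : ℝ, hankelLoop c (mlIntegrand ρ x μ) a = 2 * π * I * ML ρ μ (-x) := by
  have hρ0 : 0 < ρ := by linarith
  have hcos := cos_pos_of_abs_lt hc
  have hnorm : ‖x‖ = r := by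
    rw [hx, norm_mul, Complex.norm_exp_ofReal_mul_I, mul_one, Complex.norm_of_nonneg hr.le]
  obtain ⟨a, ha⟩ : ∃ a : ℝ, r * Real.exp (-a / ρ) = 1 / 2 := by
    refine ⟨ρ * Real.log (2 * r), ?_⟩
    rw [neg_div, mul_div_cancel_left₀ _ hρ0.ne', Real.exp_neg, Real.exp_log (by positivity)]
    field_simp
  refine ⟨a, ?_⟩
  set q := Real.exp (-a / ρ)
  have hpow : ∀ (n : ℕ) (N : ℝ), r ^ n * (q ^ n * N) = N * (1 / 2) ^ n := by
    intro n N
    rw [← ha, mul_pow]; ring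
  have hbound : ∀ (F G : ℂ → ℂ) (σ : ℝ) (n : ℕ), HankelAdmissible c σ F →
      (∀ w, G w = F w * Complex.exp (-((n : ℂ) / ρ * w))) →
      ‖(-x) ^ n * hankelLoop c G a‖ ≤ hankelNorm c F a * (1 / 2) ^ n := by
    intro F G σ n hF hG
    rw [norm_mul, norm_pow, norm_neg, hnorm, ← hpow]
    gcongr
    refine norm_hankelLoop_le hF.differentiableAt
      (hF.integrableOn_horizontal hcos (abs_add_pi_sub c) (Real.cos_add_pi c) a)
      (hF.integrableOn_horizontal hcos (abs_sub_pi_sub c) (Real.cos_sub_pi c) a)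
      fun w hw _ => ?_
    rw [hG, norm_mul, mul_comm]
    gcongr
    exact norm_exp_neg_nat_div_mul_le hρ0 n hw
  have hgeom : Summable fun n : ℕ => ((1 : ℝ) / 2) ^ n := summable_geometric_two
  have hsummable : Summable fun n : ℕ =>
      2 * π * I * ((-x) ^ n * (Complex.Gamma (μ + n / ρ))⁻¹) := by
    refine Summable.of_norm_bounded (hgeom.mul_left (hankelNorm c (hankelExp μ) a)) fun n => ?_
    rw [mul_left_comm, ← hankelLoop_hankelExp hc _ a]
    exact hbound _ _ _ n (hankelAdmissible_hankelExp c μ) fun w => hankelExp_add μ (n / ρ) w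
  have hpartial : ∀ n : ℕ, ∑ k ∈ Finset.range n,
      2 * π * I * ((-x) ^ k * (Complex.Gamma (μ + k / ρ))⁻¹) =
        hankelLoop c (mlIntegrand ρ x μ) a -
          (-x) ^ n * hankelLoop c (mlIntegrand ρ x (μ + n / ρ)) a := by
    intro n
    induction n with
    | zero => simp
    | succ n ih =>
      have h := hankelLoop_mlIntegrand_add hρ hr.le hx hc (μ + n / ρ) a
      have h1 : μ + ((n + 1 : ℕ) : ℂ) / ρ = μ + n / ρ + 1 / ρ := by push_cast; ring
      rw [Finset.sum_range_succ, ih, h1, mul_left_comm, ← h]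
      ring
  have hrem : Tendsto (fun n : ℕ =>
      (-x) ^ n * hankelLoop c (mlIntegrand ρ x (μ + n / ρ)) a) atTop (𝓝 0) := by
    refine squeeze_zero_norm (fun n => hbound _ _ _ n (hankelAdmissible_mlIntegrand hρ hr.le hx μ)
      fun w => ?_) (by simpa using hgeom.tendsto_atTop_zero.const_mul _)
    rw [mlIntegrand, mlIntegrand, hankelExp_add]
    ring
  have hlim := hsummable.hasSum.tendsto_sum_nat
  simp only [hpartial] at hlim
  have h := tendsto_nhds_unique hlim (hrem.const_sub _)
  rw [sub_zero, tsum_mul_left] at h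
  rw [ML, h]

lemma div_sub_div_eq_of_reciprocal {u B E : ℂ} (hu : u ≠ 0) (hB : B ≠ 0) (hE : E ≠ 0)
    (h₁ : 1 + u⁻¹ * E⁻¹ ≠ 0) (h₂ : 1 + u⁻¹ * E ≠ 0) :
    B / (1 + u⁻¹ * E⁻¹) - B⁻¹ / (1 + u⁻¹ * E) =
      u * (u * (B - B⁻¹) + (B * E - B⁻¹ * E⁻¹)) / (u ^ 2 + u * (E + E⁻¹) + 1) := by
  have h : u ^ 2 + u * (E + E⁻¹) + 1 = u ^ 2 * ((1 + u⁻¹ * E⁻¹) * (1 + u⁻¹ * E)) := by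
    field_simp
    ring
  rw [h, div_sub_div _ _ h₁ h₂, div_eq_div_iff (mul_ne_zero h₁ h₂)
    (mul_ne_zero (pow_ne_zero 2 hu) (mul_ne_zero h₁ h₂))]
  field_simp
  ring

lemma mul_exp_neg_div_eq (hρ : ρ ≠ 0) (hr : r ≠ 0)
    (hx : x = r * Complex.exp ((c / ρ : ℝ) * I)) (t y : ℝ) :
    x * Complex.exp (-(t + ((c + y : ℝ) : ℂ) * I) / ρ) =
      ((Real.exp (t / ρ) / r : ℝ) : ℂ)⁻¹ * Complex.exp (-(y / ρ * I)) := by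
  have hr' : (r : ℂ) ≠ 0 := by exact_mod_cast hr
  have hρ' : (ρ : ℂ) ≠ 0 := by exact_mod_cast hρ
  rw [hx]
  push_cast
  rw [inv_div, div_eq_mul_inv (r : ℂ), ← Complex.exp_neg, mul_assoc, mul_assoc, ← Complex.exp_add,
    ← Complex.exp_add]
  congr 2
  field_simp
  ring

lemma stripEdge_mlIntegrand (hρ : 1 < ρ) (hr : 0 < r)
    (hx : x = r * Complex.exp ((c / ρ : ℝ) * I)) (μ : ℂ) (t : ℝ) :
    stripEdge c (mlIntegrand ρ x μ) t = 2 * π * I *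
      (|Real.exp (t / ρ) / ρ / r| • KpiF ρ μ r (c / ρ + π) (Real.exp (t / ρ) / r)) := by
  have hρ0 : 0 < ρ := by linarith
  have hρ' : (ρ : ℂ) ≠ 0 := by exact_mod_cast hρ0.ne'
  have hpi : (π : ℂ) ≠ 0 := by exact_mod_cast Real.pi_ne_zero
  have hup := mlDenominator_ne_zero hρ hr.le hx (w := t + ((c + π : ℝ) : ℂ) * I)
    (by simpa using abs_add_pi_sub c)
  have hlow := mlDenominator_ne_zero hρ hr.le hx (w := t + ((c + -π : ℝ) : ℂ) * I)
    (by simpa using abs_sub_pi_sub c)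
  have hxup := mul_exp_neg_div_eq hρ0.ne' hr.ne' hx t π
  have hxlow := mul_exp_neg_div_eq hρ0.ne' hr.ne' hx t (-π)
  have hxlow' : Complex.exp (-(((-π : ℝ) : ℂ) / ρ * I)) = Complex.exp (π / ρ * I) := by
    push_cast; ring_nf
  rw [hxlow'] at hxlow
  rw [hxup, Complex.exp_neg] at hup
  rw [hxlow] at hlow
  rw [stripEdge, mlIntegrand, mlIntegrand, hankelExp_add_pi, hankelExp_sub_pi, hxup,
    sub_eq_add_neg c π, hxlow, Complex.exp_neg (π / ρ * I), neg_mul, Complex.exp_neg (_ * I),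
    mul_div_assoc, mul_div_assoc, ← mul_sub]
  set u : ℝ := Real.exp (t / ρ) / r with hu
  have hu0 : 0 < u := by positivity
  have huc : (u : ℂ) ≠ 0 := by exact_mod_cast hu0.ne'
  rw [div_sub_div_eq_of_reciprocal huc (Complex.exp_ne_zero _) (Complex.exp_ne_zero _) hup hlow]
  have hlog : Real.log (r * u) = t / ρ := by
    rw [hu, mul_div_cancel₀ _ hr.ne', Real.log_exp]
  have harg : (ρ : ℂ) * (((t / ρ : ℝ) : ℂ) + I * ((c / ρ + π - π : ℝ) : ℂ)) = t + c * I := by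
    push_cast
    field_simp
    ring
  have habs : |Real.exp (t / ρ) / ρ / r| = u / ρ := by
    rw [abs_of_pos (by positivity), hu]; ring
  have harg' : (ρ : ℂ) * (1 - μ) * (((t / ρ : ℝ) : ℂ) + I * ((c / ρ + π - π : ℝ) : ℂ)) =
      (1 - μ) * (t + c * I) := by rw [← harg]; ring
  have hden : ((u ^ 2 + 2 * u * Real.cos (π / ρ) + 1 : ℝ) : ℂ) =
      (u : ℂ) ^ 2 + u * (Complex.exp (π / ρ * I) + (Complex.exp (π / ρ * I))⁻¹) + 1 := by
    rw [← Complex.exp_neg]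
    push_cast
    rw [Complex.cos]
    ring_nf
  have hsin : ∀ z : ℂ, Complex.exp (z * I) - (Complex.exp (z * I))⁻¹ = 2 * I * Complex.sin z := by
    intro z
    rw [← Complex.exp_neg, Complex.sin, ← neg_mul]
    linear_combination (-(Complex.exp (-z * I) - Complex.exp (z * I))) * Complex.I_sq
  rw [habs, KpiF, hlog, harg, harg', hden, ← mul_inv, ← Complex.exp_add, ← add_mul, hsin, hsin,
    Complex.exp_add, Complex.real_smul]
  push_cast
  field_simp

end MittagLeffler

/-- Corollary 3, item 2: representation "B" with `δρ = π/ρ`, `ρ > 1`. -/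
theorem mittagLeffler_repr_B_piRho
    (ρ R θ : ℝ) (μ : ℂ)
    (hρ : 1 < ρ) (hμ : μ.re < 1 + 1 / ρ)
    (hR : 0 < R)
    (hθl : π - π / (2 * ρ) < θ) (hθu : θ < π + π / (2 * ρ)) :
    ML ρ μ ((R : ℂ) * Complex.exp (Complex.I * (θ : ℂ))) =
      ∫ r in Set.Ioi (0 : ℝ), KpiF ρ μ R θ r := by
  have hρ0 : 0 < ρ := by linarith
  set c : ℝ := ρ * (θ - π) with hcdef
  have hcθ : c / ρ = θ - π := by rw [hcdef]; field_simp
  have hc : |c| < π / 2 := by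
    have h : ρ * (π / (2 * ρ)) = π / 2 := by field_simp
    rw [abs_lt, hcdef, ← h, ← mul_neg]
    constructor <;> gcongr <;> linarith
  set x : ℂ := R * Complex.exp ((c / ρ : ℝ) * I) with hx
  obtain ⟨a, ha⟩ := hankelLoop_mlIntegrand hρ hR hx hc μ
  have hz : (R : ℂ) * Complex.exp (I * θ) = -x := by
    rw [hx, hcθ, Complex.ofReal_sub, sub_mul, Complex.exp_sub_pi_mul_I, mul_comm I]
    ring
  rw [(hankelAdmissible_mlIntegrand_of_pos hρ hR hx μ).hankelLoop_eq (cos_pos_of_abs_lt hc)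
    (by linarith)] at ha
  simp only [stripEdge_mlIntegrand hρ hR hx, hcθ, sub_add_cancel] at ha
  rw [MeasureTheory.integral_const_mul] at ha
  rw [hz, ← mul_left_cancel₀ Complex.two_pi_I_ne_zero ha]
  have hder : ∀ t ∈ (univ : Set ℝ), HasDerivWithinAt (fun t : ℝ => Real.exp (t / ρ) / R)
      (Real.exp (t / ρ) / ρ / R) univ t := by
    intro t _
    have h := ((((hasDerivAt_id t).div_const ρ).exp).div_const R).hasDerivWithinAt (s := univ)
    simpa [div_eq_mul_inv] using h
  have hinj : InjOn (fun t : ℝ => Real.exp (t / ρ) / R) univ := by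
    intro t _ t' _ h
    simpa [hR.ne', hρ0.ne', div_left_inj'] using h
  have himg : (fun t : ℝ => Real.exp (t / ρ) / R) '' univ = Ioi 0 := by
    ext y
    constructor
    · rintro ⟨t, -, rfl⟩
      exact div_pos (Real.exp_pos _) hR
    · intro hy
      refine ⟨ρ * Real.log (R * y), mem_univ _, ?_⟩
      simp only
      rw [mul_div_cancel_left₀ _ hρ0.ne', Real.exp_log (mul_pos hR hy),
        mul_div_cancel_left₀ _ hR.ne']
  rw [← himg, integral_image_eq_integral_abs_deriv_smul MeasurableSet.univ hder hinj,
    setIntegral_univ]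
end

section
/- Let ρ > 1/2 and let μ ∈ ℂ with Re μ < 1 + 1/ρ. Let z = R·exp(iθ) with R > 0 and θ ∈ ℝ, and let δ₁, δ₂ be real numbers with δ₁ > 0 and δ₂ > 0. Then the integral over the small circular arc tends to zero as its radius shrinks: the limit as ε → 0⁺ of ∫_{δ₂−π}^{−δ₁−π} [φ_{ρ,μ}(ε, φ, z) / (ε·e^{iφ} − 1)] · ε·e^{iφ} dφ equals 0. -/
open scoped Real
open MeasureTheory intervalIntegral

/-- A uniform bound for `phiFun` on arcs of radius less than one. -/
lemma norm_phiFun_le {ρ R θ r φ M : ℝ} (μ : ℂ) (hρ : 0 < ρ) (hR : 0 < R) (hr : 0 < r)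
    (hr1 : r < 1) (hM : |θ + φ| ≤ M) :
    ‖phiFun ρ μ R θ r φ‖ ≤ ‖(ρ : ℂ) / (2 * (π : ℂ) * Complex.I)‖ *
      Real.exp (Real.exp (ρ * Real.log R)) *
      Real.exp (ρ * (1 - μ.re) * (Real.log R + Real.log r) + ρ * |μ.im| * M) := by
  have hlog : Real.log (R * r) = Real.log R + Real.log r := Real.log_mul hR.ne' hr.ne'
  have hlogr : Real.log r ≤ 0 := Real.log_nonpos hr.le hr1.le
  unfold phiFun
  rw [norm_mul, norm_mul, Complex.norm_exp, Complex.norm_exp]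
  gcongr
  · refine (Complex.re_le_norm _).trans ?_
    rw [Complex.norm_exp]
    have hre : ((ρ : ℂ) * ((Real.log (R * r) : ℂ) + Complex.I * ((θ + φ : ℝ) : ℂ))).re
        = ρ * (Real.log R + Real.log r) := by
      rw [hlog]; simp
    rw [hre]
    gcongr
    linarith
  · have hre : ((ρ : ℂ) * (1 - μ) *
        ((Real.log (R * r) : ℂ) + Complex.I * ((θ + φ : ℝ) : ℂ))).re
        = ρ * (1 - μ.re) * (Real.log R + Real.log r) + ρ * (μ.im * (θ + φ)) := by
      rw [hlog]
      simp only [Complex.mul_re, Complex.mul_im, Complex.add_re, Complex.add_im, Complex.sub_re,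
        Complex.sub_im, Complex.one_re, Complex.one_im, Complex.ofReal_re, Complex.ofReal_im,
        Complex.I_re, Complex.I_im]
      ring
    have him : μ.im * (θ + φ) ≤ |μ.im| * M :=
      (le_abs_self _).trans (by rw [abs_mul]; gcongr)
    rw [hre, mul_assoc ρ |μ.im| M]
    gcongr

/-- Near the origin, `ζ / (ζ - 1)` is controlled by `2 |ζ|`. -/
lemma norm_div_sub_one_mul_le {ζ : ℂ} (w : ℂ) (hζ : ‖ζ‖ ≤ 1 / 2) :
    ‖w / (ζ - 1) * ζ‖ ≤ ‖w‖ * (2 * ‖ζ‖) := by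
  have hden : 1 / 2 ≤ ‖ζ - 1‖ := by
    have h := norm_sub_norm_le (1 : ℂ) ζ
    rw [norm_one, norm_sub_rev] at h
    linarith
  have hdiv : ‖w‖ / ‖ζ - 1‖ ≤ ‖w‖ * 2 := by
    rw [div_le_iff₀ (by linarith)]
    nlinarith [norm_nonneg w]
  rw [norm_mul, norm_div, ← mul_assoc]
  gcongr

/-- The integral over the small circular arc `C_ε` tends to zero as `ε → 0⁺`
when `Re μ < 1 + 1/ρ`. -/
theorem small_arc_integral_tendsto_zero
    (ρ R θ δ₁ δ₂ : ℝ) (μ : ℂ)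
    (hρ : 1 / 2 < ρ) (hμ : μ.re < 1 + 1 / ρ) (hR : 0 < R)
    (hδ₁ : 0 < δ₁) (hδ₂ : 0 < δ₂) :
    Filter.Tendsto
      (fun ε : ℝ => ∫ φ in (δ₂ - π)..(-δ₁ - π),
        phiFun ρ μ R θ ε φ / ((ε : ℂ) * Complex.exp (Complex.I * (φ : ℂ)) - 1) *
          ((ε : ℂ) * Complex.exp (Complex.I * (φ : ℂ))))
      (nhdsWithin 0 (Set.Ioi 0)) (nhds 0) := by
  have hρ0 : 0 < ρ := by linarith
  have hexp : 0 < ρ * (1 - μ.re) + 1 := by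
    have h := mul_lt_mul_of_pos_left hμ hρ0
    rw [mul_add, mul_one_div_cancel hρ0.ne'] at h
    linarith
  set M : ℝ := |θ| + (π + δ₁ + δ₂) with hM
  set K : ℝ := ‖(ρ : ℂ) / (2 * (π : ℂ) * Complex.I)‖ * Real.exp (Real.exp (ρ * Real.log R)) *
    Real.exp (ρ * (1 - μ.re) * Real.log R + ρ * |μ.im| * M) * 2 *
      |(-δ₁ - π) - (δ₂ - π)| with hK
  have hlim : Filter.Tendsto
      (fun ε : ℝ => K * Real.exp ((ρ * (1 - μ.re) + 1) * Real.log ε))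
      (nhdsWithin 0 (Set.Ioi 0)) (nhds 0) := by
    simpa using (Real.tendsto_exp_atBot.comp
      (Real.tendsto_log_nhdsGT_zero.const_mul_atBot hexp)).const_mul K
  refine squeeze_zero_norm' ?_ hlim
  filter_upwards [Ioo_mem_nhdsGT (show (0 : ℝ) < 1 / 2 by norm_num)] with ε hε
  obtain ⟨hε0, hε1⟩ := hε
  refine (intervalIntegral.norm_integral_le_of_norm_le_const
    (C := ‖(ρ : ℂ) / (2 * (π : ℂ) * Complex.I)‖ * Real.exp (Real.exp (ρ * Real.log R)) *
      Real.exp (ρ * (1 - μ.re) * (Real.log R + Real.log ε) + ρ * |μ.im| * M) * (2 * ε))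
    fun φ hφ => ?_).trans_eq ?_
  · rw [Set.uIoc_of_ge (by linarith)] at hφ
    have hφM : |θ + φ| ≤ M := by
      refine (abs_add_le _ _).trans ?_
      have : |φ| ≤ π + δ₁ + δ₂ := abs_le.2 ⟨by linarith [hφ.1], by linarith [hφ.2, Real.pi_pos]⟩
      linarith
    have hζ : ‖(ε : ℂ) * Complex.exp (Complex.I * (φ : ℂ))‖ = ε := by
      rw [norm_mul, Complex.norm_exp_I_mul_ofReal, mul_one, Complex.norm_of_nonneg hε0.le]
    refine (norm_div_sub_one_mul_le _ (hζ.trans_le hε1.le)).trans ?_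
    rw [hζ]
    gcongr
    exact norm_phiFun_le μ hρ0 hR hε0 (by linarith) hφM
  · have hsplit : Real.exp (ρ * (1 - μ.re) * (Real.log R + Real.log ε) + ρ * |μ.im| * M) * ε =
        Real.exp (ρ * (1 - μ.re) * Real.log R + ρ * |μ.im| * M) *
          Real.exp ((ρ * (1 - μ.re) + 1) * Real.log ε) := by
      nth_rewrite 2 [← Real.exp_log hε0]
      rw [← Real.exp_add, ← Real.exp_add]
      ring_nf
    rw [hK]
    linear_combination ‖(ρ : ℂ) / (2 * (π : ℂ) * Complex.I)‖ *
      Real.exp (Real.exp (ρ * Real.log R)) * 2 * |(-δ₁ - π) - (δ₂ - π)| * hsplit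
end

section
/- Let ρ > 1/2, ϵ > 0, and let μ ∈ ℂ with Re μ < 1 + 1/ρ. Let δ₁, δ₂ be real numbers satisfying: π/(2ρ) < δ₁ ≤ π/ρ and π/(2ρ) < δ₂ ≤ π/ρ if ρ > 1; π/(2ρ) < δ₁ < π and π/(2ρ) < δ₂ < π if 1/2 < ρ ≤ 1. Let z = R·exp(iθ) with R > 0 and θ ∈ ℝ. Then the integral over the arc of radius 1+ϵ equals the difference of the two radial integrals: i·∫_{−δ₁−π}^{δ₂−π} φ_{ρ,μ}(1+ϵ, φ, z)·(1+ϵ)·e^{iφ}/((1+ϵ)·e^{iφ} − 1) dφ = ∫_{0}^{1+ϵ} φ_{ρ,μ}(r, δ₂−π, z)·e^{i(δ₂−π)}/(r·e^{i(δ₂−π)} − 1) dr − ∫_{0}^{1+ϵ} φ_{ρ,μ}(r, −δ₁−π, z)·e^{i(−δ₁−π)}/(r·e^{i(−δ₁−π)} − 1) dr. -/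
open scoped Real
open MeasureTheory intervalIntegral

open Filter Topology

/-- Cauchy's theorem on a sector of an annulus, for a function given in polar coordinates whose
product with `r` is holomorphic in the logarithmic coordinate `log r + iφ`. -/
theorem polar_rect_integral_eq_zero {f : ℝ → ℝ → ℂ} {g : ℂ → ℂ} {a b α β : ℝ}
    (ha : 0 < a) (hb : 0 < b)
    (hfg : ∀ s φ : ℝ, (Real.exp s : ℂ) * f (Real.exp s) φ = g (s + φ * Complex.I))
    (hg : DifferentiableOn ℂ g
      (Set.uIcc (Real.log a) (Real.log b) ×ℂ Set.uIcc α β)) :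
    (∫ r in a..b, f r α) - (∫ r in a..b, f r β) + Complex.I * (∫ φ in α..β, (b : ℂ) * f b φ) -
      Complex.I * (∫ φ in α..β, (a : ℂ) * f a φ) = 0 := by
  have hradial : ∀ φ : ℝ, ∫ r in a..b, f r φ =
      ∫ s in (Real.log a)..(Real.log b), g (s + φ * Complex.I) := by
    intro φ
    have h := integral_deriv_smul_comp_of_deriv_nonneg (a := Real.log a) (b := Real.log b)
      (f := Real.exp) (f' := Real.exp) (g := fun r => f r φ) Real.continuous_exp.continuousOn
      (fun x _ => Real.hasDerivAt_exp x) (fun x _ => (Real.exp_pos x).le)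
    rw [Real.exp_log ha, Real.exp_log hb] at h
    rw [← h]
    refine integral_congr fun s _ => ?_
    simp only [Function.comp, Complex.real_smul, hfg]
  have harc : ∀ r : ℝ, 0 < r → ∫ φ in α..β, (r : ℂ) * f r φ =
      ∫ φ in α..β, g (Real.log r + φ * Complex.I) := by
    intro r hr
    refine integral_congr fun φ _ => ?_
    simp only [← hfg, Real.exp_log hr]
  have h := Complex.integral_boundary_rect_eq_zero_of_differentiableOn g
    ⟨Real.log a, α⟩ ⟨Real.log b, β⟩ hg
  simpa only [hradial, harc a ha, harc b hb, smul_eq_mul] using h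

/-- Cauchy's theorem on a sector, for a function given in polar coordinates with an integrable
power singularity at the vertex. -/
theorem sector_integral_eq {f H : ℝ → ℝ → ℂ} {g : ℂ → ℂ} {b α β : ℝ} {q : ℂ}
    (hb : 0 < b) (hαβ : α ≤ β) (hq : -1 < q.re)
    (hfg : ∀ s φ : ℝ, (Real.exp s : ℂ) * f (Real.exp s) φ = g (s + φ * Complex.I))
    (hg : DifferentiableOn ℂ g (Set.univ ×ℂ Set.Icc α β))
    (hfH : ∀ r φ : ℝ, 0 < r → f r φ = H r φ * (r : ℂ) ^ q)
    (hH : ContinuousOn (Function.uncurry H) (Set.Icc 0 b ×ˢ Set.Icc α β)) :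
    Complex.I * (∫ φ in α..β, (b : ℂ) * f b φ) =
      (∫ r in (0 : ℝ)..b, f r β) - ∫ r in (0 : ℝ)..b, f r α := by
  have hint : ∀ φ ∈ Set.Icc α β, IntegrableOn (fun r => f r φ) (Set.uIcc 0 b) := by
    intro φ hφ
    have hc : ContinuousOn (fun r => H r φ) (Set.uIcc 0 b) := by
      rw [Set.uIcc_of_le hb.le]
      exact hH.comp (f := fun r => (r, φ)) (by fun_prop) fun r hr => ⟨hr, hφ⟩
    have h := (intervalIntegrable_cpow' (a := 0) (b := b) hq).continuousOn_mul hc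
    rw [Set.uIcc_of_le hb.le, integrableOn_Icc_iff_integrableOn_Ioc]
    rw [intervalIntegrable_iff_integrableOn_Ioc_of_le hb.le] at h
    exact h.congr_fun (fun r hr => (hfH r φ hr.1).symm) measurableSet_Ioc
  have hnhds : 𝓝[Set.Ioc 0 b] (0 : ℝ) = 𝓝[>] 0 := nhdsWithin_Ioc_eq_nhdsGT hb
  have hlim : ∀ φ ∈ Set.Icc α β,
      Tendsto (fun a => ∫ r in a..b, f r φ) (𝓝[>] 0) (𝓝 (∫ r in (0 : ℝ)..b, f r φ)) := by
    intro φ hφ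
    have h := continuousOn_primitive_interval_left (hint φ hφ) 0 Set.left_mem_uIcc
    rw [← hnhds]
    refine h.mono_left (nhdsWithin_mono _ ?_)
    rw [Set.uIcc_of_le hb.le]
    exact Set.Ioc_subset_Icc_self
  obtain ⟨M, hM⟩ := (isCompact_Icc.prod isCompact_Icc).exists_bound_of_continuousOn hH
  have harc : Tendsto (fun a : ℝ => ∫ φ in α..β, (a : ℂ) * f a φ) (𝓝[>] 0) (𝓝 0) := by
    have hpow : Tendsto (fun a : ℝ => M * a ^ (1 + q.re) * |β - α|) (𝓝[>] 0) (𝓝 0) := by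
      have h : Tendsto (fun a : ℝ => a ^ (1 + q.re)) (𝓝[>] 0) (𝓝 0) := by
        have := (Real.continuousAt_rpow_const 0 (1 + q.re) (Or.inr (by linarith))).tendsto
        rw [Real.zero_rpow (by linarith)] at this
        exact this.mono_left nhdsWithin_le_nhds
      simpa using (h.const_mul M).mul_const |β - α|
    refine squeeze_zero_norm' ?_ hpow
    rw [← hnhds]
    filter_upwards [self_mem_nhdsWithin] with a ha
    refine norm_integral_le_of_norm_le_const fun φ hφ => ?_
    rw [Set.uIoc_of_le hαβ] at hφ
    have hMa := hM (a, φ) ⟨Set.Ioc_subset_Icc_self ha, Set.Ioc_subset_Icc_self hφ⟩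
    rw [hfH a φ ha.1, norm_mul, norm_mul, Complex.norm_cpow_eq_rpow_re_of_pos ha.1,
      Complex.norm_real, Real.norm_of_nonneg ha.1.le, Real.rpow_add ha.1, Real.rpow_one]
    have := mul_le_mul_of_nonneg_right hMa
      (mul_nonneg ha.1.le (Real.rpow_nonneg ha.1.le q.re))
    calc a * (‖H a φ‖ * a ^ q.re) = ‖H a φ‖ * (a * a ^ q.re) := by ring
      _ ≤ _ := this
  have hzero := (((hlim α ⟨le_rfl, hαβ⟩).sub (hlim β ⟨hαβ, le_rfl⟩)).add_const
    (Complex.I * (∫ φ in α..β, (b : ℂ) * f b φ))).sub (harc.const_mul Complex.I)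
  have heq : (fun a : ℝ => (∫ r in a..b, f r α) - (∫ r in a..b, f r β) +
      Complex.I * (∫ φ in α..β, (b : ℂ) * f b φ) -
      Complex.I * (∫ φ in α..β, (a : ℂ) * f a φ)) =ᶠ[𝓝[>] 0] fun _ => 0 := by
    filter_upwards [self_mem_nhdsWithin] with a ha
    refine polar_rect_integral_eq_zero ha hb hfg (hg.mono ?_)
    rw [Set.uIcc_of_le hαβ]
    exact fun w hw => ⟨trivial, hw.2⟩
  have := tendsto_nhds_unique hzero (tendsto_const_nhds.congr' heq.symm)
  linear_combination this

theorem exp_ne_one_of_im_mem_Ioo {w : ℂ} (h₁ : -(2 * π) < w.im) (h₂ : w.im < 0) :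
    Complex.exp w ≠ 1 := by
  intro h
  obtain ⟨n, hn⟩ := Complex.exp_eq_one_iff.1 h
  have him : w.im = n * (2 * π) := by simpa using congrArg Complex.im hn
  have hπ := Real.pi_pos
  rw [him] at h₁ h₂
  have hn₁ : (-1 : ℝ) < n := by nlinarith
  have hn₂ : (n : ℝ) < 0 := by nlinarith
  norm_cast at hn₁ hn₂
  lia

theorem real_mul_exp_I_mul_ne_one {r φ : ℝ} (hr : 0 ≤ r) (h₁ : -(2 * π) < φ) (h₂ : φ < 0) :
    (r : ℂ) * Complex.exp (Complex.I * φ) ≠ 1 := by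
  rcases hr.eq_or_lt with rfl | hr
  · simp
  · have h := exp_ne_one_of_im_mem_Ioo (w := Real.log r + Complex.I * φ) (by simpa using h₁)
      (by simpa using h₂)
    rwa [Complex.exp_add, ← Complex.ofReal_exp, Real.exp_log hr] at h

theorem phiFun_eq_mul_cpow {ρ R r : ℝ} (μ : ℂ) (θ φ : ℝ) (hR : 0 < R) (hr : 0 < r) :
    phiFun ρ μ R θ r φ = ((ρ : ℂ) / (2 * (π : ℂ) * Complex.I)) *
      Complex.exp (((r ^ ρ : ℝ) : ℂ) *
        Complex.exp ((ρ : ℂ) * ((Real.log R : ℂ) + Complex.I * ((θ + φ : ℝ) : ℂ)))) *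
      Complex.exp ((ρ : ℂ) * (1 - μ) * ((Real.log R : ℂ) + Complex.I * ((θ + φ : ℝ) : ℂ))) *
      (r : ℂ) ^ ((ρ : ℂ) * (1 - μ)) := by
  have hr' : (r : ℂ) ≠ 0 := by exact_mod_cast hr.ne'
  rw [phiFun, Real.log_mul hR.ne' hr.ne', Complex.cpow_def_of_ne_zero hr',
    ← Complex.ofReal_log hr.le, Real.rpow_def_of_pos hr, Complex.ofReal_exp]
  push_cast
  simp only [mul_add, Complex.exp_add]
  ring_nf

/-- The integral over the arc of radius `1+ϵ` equals the difference of the two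
radial integrals (consequence of Cauchy's theorem, for `Re μ < 1 + 1/ρ`). -/
theorem arc_integral_eq_radial_difference
    (ρ ϵ δ₁ δ₂ R θ : ℝ) (μ : ℂ)
    (hρ : 1 / 2 < ρ) (hϵ : 0 < ϵ) (hμ : μ.re < 1 + 1 / ρ)
    (hδ : (1 < ρ ∧ π / (2 * ρ) < δ₁ ∧ δ₁ ≤ π / ρ ∧ π / (2 * ρ) < δ₂ ∧ δ₂ ≤ π / ρ) ∨
          (ρ ≤ 1 ∧ π / (2 * ρ) < δ₁ ∧ δ₁ < π ∧ π / (2 * ρ) < δ₂ ∧ δ₂ < π))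
    (hR : 0 < R) :
    Complex.I * (∫ φ in (-δ₁ - π)..(δ₂ - π),
        phiFun ρ μ R θ (1 + ϵ) φ * (((1 + ϵ : ℝ) : ℂ) * Complex.exp (Complex.I * (φ : ℂ))) /
          (((1 + ϵ : ℝ) : ℂ) * Complex.exp (Complex.I * (φ : ℂ)) - 1)) =
      (∫ r in (0 : ℝ)..(1 + ϵ),
        phiFun ρ μ R θ r (δ₂ - π) * Complex.exp (Complex.I * ((δ₂ - π : ℝ) : ℂ)) /
          ((r : ℂ) * Complex.exp (Complex.I * ((δ₂ - π : ℝ) : ℂ)) - 1))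
      - ∫ r in (0 : ℝ)..(1 + ϵ),
        phiFun ρ μ R θ r (-δ₁ - π) * Complex.exp (Complex.I * ((-δ₁ - π : ℝ) : ℂ)) /
          ((r : ℂ) * Complex.exp (Complex.I * ((-δ₁ - π : ℝ) : ℂ)) - 1) := by
  have hπ := Real.pi_pos
  have hρ₀ : 0 < ρ := by linarith
  have hδ' : 0 < δ₁ ∧ δ₁ < π ∧ 0 < δ₂ ∧ δ₂ < π := by
    have h₀ : 0 < π / (2 * ρ) := by positivity
    rcases hδ with ⟨h, h₁, h₂, h₃, h₄⟩ | ⟨_, h₁, h₂, h₃, h₄⟩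
    · have := div_lt_self hπ h
      refine ⟨?_, ?_, ?_, ?_⟩ <;> linarith
    · refine ⟨?_, ?_, ?_, ?_⟩ <;> linarith
  obtain ⟨hδ₁, hδ₁', hδ₂, hδ₂'⟩ := hδ'
  have hq : -1 < ((ρ : ℂ) * (1 - μ)).re := by
    have h := mul_lt_mul_of_pos_left hμ hρ₀
    rw [mul_add, mul_one_div_cancel hρ₀.ne'] at h
    simp only [Complex.re_ofReal_mul, Complex.sub_re, Complex.one_re]
    linarith
  have key := sector_integral_eq (b := 1 + ϵ) (α := -δ₁ - π) (β := δ₂ - π)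
    (f := fun r φ => phiFun ρ μ R θ r φ * Complex.exp (Complex.I * (φ : ℂ)) /
      ((r : ℂ) * Complex.exp (Complex.I * (φ : ℂ)) - 1))
    (H := fun r φ => ((ρ : ℂ) / (2 * (π : ℂ) * Complex.I)) *
      Complex.exp (((r ^ ρ : ℝ) : ℂ) *
        Complex.exp ((ρ : ℂ) * ((Real.log R : ℂ) + Complex.I * ((θ + φ : ℝ) : ℂ)))) *
      Complex.exp ((ρ : ℂ) * (1 - μ) * ((Real.log R : ℂ) + Complex.I * ((θ + φ : ℝ) : ℂ))) *
      Complex.exp (Complex.I * (φ : ℂ)) / ((r : ℂ) * Complex.exp (Complex.I * (φ : ℂ)) - 1))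
    (g := fun w => ((ρ : ℂ) / (2 * (π : ℂ) * Complex.I)) *
      Complex.exp (Complex.exp ((ρ : ℂ) * ((Real.log R : ℂ) + w + Complex.I * θ))) *
      Complex.exp ((ρ : ℂ) * (1 - μ) * ((Real.log R : ℂ) + w + Complex.I * θ)) *
      Complex.exp w / (Complex.exp w - 1))
    (q := (ρ : ℂ) * (1 - μ)) (by linarith) (by linarith) hq ?_ ?_ ?_ ?_
  · rw [← key]
    congr 1
    refine integral_congr fun φ _ => ?_
    ring
  · intro s φ
    simp only [phiFun, Real.log_mul hR.ne' (Real.exp_pos s).ne', Real.log_exp, Complex.exp_add,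
      Complex.ofReal_exp, mul_comm (φ : ℂ) Complex.I]
    push_cast
    simp only [mul_add, Complex.exp_add]
    ring_nf
  · intro w hw
    have hne := sub_ne_zero.2 (exp_ne_one_of_im_mem_Ioo (w := w) (by linarith [hw.2.1])
      (by linarith [hw.2.2]))
    refine DifferentiableAt.differentiableWithinAt ?_
    exact DifferentiableAt.div (by fun_prop) (by fun_prop) hne
  · intro r φ hr
    simp only [phiFun_eq_mul_cpow μ θ φ hR hr]
    ring
  · refine ContinuousOn.div ?_ (by fun_prop) ?_
    · have : Continuous fun x : ℝ × ℝ => x.1 ^ ρ :=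
        continuous_fst.rpow_const fun _ => Or.inr hρ₀.le
      refine Continuous.continuousOn ?_
      fun_prop
    · rintro ⟨r, φ⟩ ⟨hr, hφ⟩
      exact sub_ne_zero.2 (real_mul_exp_I_mul_ne_one hr.1 (by linarith [hφ.1])
        (by linarith [hφ.2]))
end

section
/- Let ρ > 1/2, μ ∈ ℂ, and let z = R·exp(iθ) with R > 0 and θ ∈ ℝ. Then for every r > 0 and every real δ, the kernel functions satisfy the identity K′_{ρ,μ}(r, δ, z) − K′_{ρ,μ}(r, −δ, z) = K_{ρ,μ}(r, δ, z), where K_{ρ,μ}(r, φ, z) is the symmetric kernel. -/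
open scoped Real
open MeasureTheory intervalIntegral

/-- The phase function `η(r,φ)` is odd in `φ`. -/
theorem etaF_neg (ρ : ℝ) (μ : ℂ) (R θ r φ : ℝ) :
    etaF ρ μ R θ r (-φ) = -etaF ρ μ R θ r φ := by
  simp only [etaF, Complex.ofReal_neg, mul_neg, Complex.sin_neg]
  ring

/-- `K′` with the factor independent of `φ` rotated from `arg z` to `arg z - π`. -/
theorem KpF_eq (ρ : ℝ) (μ : ℂ) (R θ r φ : ℝ) :
    KpF ρ μ R θ r φ = ((ρ : ℂ) / (2 * (π : ℂ) * Complex.I)) *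
      Complex.exp ((ρ : ℂ) * (1 - μ) *
        ((Real.log (R * r) : ℂ) + Complex.I * ((θ - π : ℝ) : ℂ))) *
      Complex.exp (Complex.exp ((ρ : ℂ) *
        ((Real.log (R * r) : ℂ) + Complex.I * ((θ - π : ℝ) : ℂ))) *
        Complex.cos ((ρ : ℂ) * (φ : ℂ))) *
      ((r : ℂ) * Complex.exp (etaF ρ μ R θ r φ * Complex.I) +
        Complex.exp ((etaF ρ μ R θ r φ + (φ : ℂ)) * Complex.I)) /
      ((r ^ 2 + 2 * r * Real.cos φ + 1 : ℝ) : ℂ) := by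
  have hrot : Complex.exp ((ρ : ℂ) * (1 - μ) * ((Real.log (R * r) : ℂ) + Complex.I * (θ : ℂ))) *
      Complex.exp (Complex.I * (etaF ρ μ R θ r φ - (π : ℂ) * (ρ : ℂ) * (1 - μ))) =
      Complex.exp ((ρ : ℂ) * (1 - μ) *
        ((Real.log (R * r) : ℂ) + Complex.I * ((θ - π : ℝ) : ℂ))) *
      Complex.exp (etaF ρ μ R θ r φ * Complex.I) := by
    rw [← Complex.exp_add, ← Complex.exp_add]
    congr 1
    push_cast
    ring
  have hadd : Complex.exp ((etaF ρ μ R θ r φ + (φ : ℂ)) * Complex.I) =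
      Complex.exp (etaF ρ μ R θ r φ * Complex.I) * Complex.exp (Complex.I * (φ : ℂ)) := by
    rw [← Complex.exp_add]
    congr 1
    ring
  rw [KpF, hadd, mul_assoc _ _ (Complex.exp (Complex.I * (etaF ρ μ R θ r φ - _))), hrot]
  ring

/-- The kernel identity `K′_{ρ,μ}(r,δ,z) - K′_{ρ,μ}(r,-δ,z) = K_{ρ,μ}(r,δ,z)`. -/
theorem kernel_difference_eq_sym_kernel
    (ρ R θ : ℝ) (μ : ℂ) (hρ : 1 / 2 < ρ) (hR : 0 < R)
    (r : ℝ) (hr : 0 < r) (δ : ℝ) :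
    KpF ρ μ R θ r δ - KpF ρ μ R θ r (-δ) = KsymF ρ μ R θ r δ := by
  have hcoef : (ρ : ℂ) / (π : ℂ) * (Complex.I / 2) =
      -((ρ : ℂ) / (2 * (π : ℂ) * Complex.I)) := by
    have hI := Complex.I_mul_I
    have hI0 := Complex.I_ne_zero
    have hpi : (π : ℂ) ≠ 0 := Complex.ofReal_ne_zero.mpr Real.pi_ne_zero
    field_simp
    linear_combination (ρ : ℂ) * hI
  rw [KpF_eq, KpF_eq, etaF_neg, KsymF]
  simp only [Complex.ofReal_neg, mul_neg, Complex.cos_neg, Real.cos_neg, ← neg_add]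
  simp only [Complex.sin]
  generalize Complex.exp (etaF ρ μ R θ r δ * Complex.I) = a
  generalize Complex.exp (-etaF ρ μ R θ r δ * Complex.I) = b
  generalize Complex.exp ((etaF ρ μ R θ r δ + (δ : ℂ)) * Complex.I) = c
  generalize Complex.exp (-(etaF ρ μ R θ r δ + (δ : ℂ)) * Complex.I) = d
  generalize Complex.exp ((ρ : ℂ) * (1 - μ) * _) = X
  generalize Complex.exp (_ * Complex.cos _) = E
  generalize ((r ^ 2 + 2 * r * Real.cos δ + 1 : ℝ) : ℂ) = D
  linear_combination -(X * E * (r * (b - a) + (d - c)) / D) * hcoef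
end
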